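/- arXiv:0905.2708 — 5 statements merged into one kernel-verified Lean document; each statement's English description precedes it below -/
import Mathlib

section
/- Let ρ be a faithful state on Mₙ(ℂ) and φ(A) = ρ(A)·I. Let τ be a non-zero positive linear functional on Mₙ(ℂ) and C ∈ Mₙ(ℂ) a non-zero positive operator, and define ψ(A) = τ(A)·C. Then ψ is q-positive, and φ ≥_q ψ if and only if ψ = λφ for some λ ∈ (0,1]. -/
open scoped ComplexOrder BigOperators
open Matrix

abbrev MatC (n : ℕ) := Matrix (Fin n) (Fin n) ℂ

/-- Complete positivity of a linear map on `Mₙ(ℂ)`: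
for all finite families `Aᵢ`, `fᵢ`, `∑ ⟨fᵢ, φ(Aᵢ* Aⱼ) fⱼ⟩ ≥ 0`. -/
def IsCP {n : ℕ} (φ : Module.End ℂ (MatC n)) : Prop :=
  ∀ (m : ℕ) (A : Fin m → MatC n) (f : Fin m → (Fin n → ℂ)),
    0 ≤ ∑ i, ∑ j, star (f i) ⬝ᵥ ((φ ((A i)ᴴ * A j)) *ᵥ f j)

/-- `φ` has no negative (real) eigenvalues. -/
def NoNegEig {n : ℕ} (φ : Module.End ℂ (MatC n)) : Prop :=
  ∀ r : ℝ, r < 0 → ¬ Module.End.HasEigenvalue φ (r : ℂ)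

/-- `φ^(t) = φ ∘ (I + t φ)⁻¹`. -/
noncomputable def qRes {n : ℕ} (φ : Module.End ℂ (MatC n)) (t : ℝ) :
    Module.End ℂ (MatC n) :=
  φ * Ring.inverse (1 + (t : ℂ) • φ)

/-- `φ` is q-positive. -/
def IsQPos {n : ℕ} (φ : Module.End ℂ (MatC n)) : Prop :=
  NoNegEig φ ∧ ∀ t : ℝ, 0 ≤ t → IsCP (qRes φ t)

/-- `φ ≥_q ψ` : `φ(I+tφ)⁻¹ − ψ(I+tψ)⁻¹` is completely positive for all `t ≥ 0`. -/
def qLE {n : ℕ} (ψ φ : Module.End ℂ (MatC n)) : Prop :=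
  ∀ t : ℝ, 0 ≤ t → IsCP (qRes φ t - qRes ψ t)

/-- `φ` is q-pure: its q-subordinates are exactly `{0} ∪ {φ^(s) : s ≥ 0}`. -/
def IsQPure {n : ℕ} (φ : Module.End ℂ (MatC n)) : Prop :=
  IsQPos φ ∧ ∀ ψ : Module.End ℂ (MatC n),
    (IsQPos ψ ∧ qLE ψ φ) ↔ (ψ = 0 ∨ ∃ s : ℝ, 0 ≤ s ∧ ψ = qRes φ s)


lemma qRes_smulRight {n : ℕ} (τ : MatC n →ₗ[ℂ] ℂ) (C : MatC n) (s : ℝ) (hs : 0 ≤ s)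
    (h : τ C = (s : ℂ)) (t : ℝ) (ht : 0 ≤ t) :
    qRes (τ.smulRight C) t = (((1 + t * s)⁻¹ : ℝ) : ℂ) •
      (τ.smulRight C : Module.End ℂ (MatC n)) := by
  have hpos : 0 < 1 + t * s := by positivity
  have hne : (1 + (t : ℂ) * s) ≠ 0 := by exact_mod_cast hpos.ne'
  set P : Module.End ℂ (MatC n) := τ.smulRight C with hP
  have hPP : P * P = (s : ℂ) • P := by
    ext1 A
    simp only [hP, Module.End.mul_apply, LinearMap.smulRight_apply, LinearMap.smul_apply, map_smul,
      h, smul_smul, smul_eq_mul]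
    rw [mul_comm]
  set c : ℂ := ((1 + (t : ℂ) * s))⁻¹ with hc
  have hcc : c * (1 + (t : ℂ) * s) = 1 := inv_mul_cancel₀ hne
  have h1 : (1 + (t : ℂ) • P) * (1 - (t * c) • P) = 1 := by
    have : (1 + (t : ℂ) • P) * (1 - (t * c) • P)
        = 1 + (t - t * c * (1 + t * s)) • P := by
      simp only [mul_sub, add_mul, one_mul, mul_one, smul_mul_assoc, mul_smul_comm, hPP]
      module
    rw [this, mul_assoc, hcc]; simp
  have h2 : (1 - (t * c) • P) * (1 + (t : ℂ) • P) = 1 := by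
    have : (1 - (t * c) • P) * (1 + (t : ℂ) • P)
        = 1 + (t - t * c * (1 + t * s)) • P := by
      simp only [sub_mul, mul_add, one_mul, mul_one, smul_mul_assoc, mul_smul_comm, hPP]
      module
    rw [this, mul_assoc, hcc]; simp
  have hinv : Ring.inverse (1 + (t : ℂ) • P) = 1 - (t * c) • P :=
    Ring.inverse_unit (⟨1 + (t : ℂ) • P, 1 - (t * c) • P, h1, h2⟩ : (Module.End ℂ (MatC n))ˣ)
  unfold qRes
  rw [hinv, mul_sub, mul_one, mul_smul_comm, hPP, smul_smul]
  have : c = 1 - t * c * s := by linear_combination hcc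
  push_cast
  rw [← hc]
  calc P - (↑t * c * ↑s) • P = (1 - t * c * s) • P := by module
    _ = c • P := by rw [← this]

lemma psd_factor {n : ℕ} {C : MatC n} (hC : C.PosSemidef) : ∃ B : MatC n, C = Bᴴ * B := by
  open scoped MatrixOrder in
  exact CStarAlgebra.nonneg_iff_eq_star_mul_self.mp hC.nonneg

lemma isCP_smulRight {n : ℕ} (τ : MatC n →ₗ[ℂ] ℂ) (C : MatC n)
    (hτpos : ∀ A : MatC n, A.PosSemidef → 0 ≤ τ A) (hC : C.PosSemidef) :
    IsCP (τ.smulRight C) := by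
  intro m A f
  obtain ⟨B, rfl⟩ := psd_factor hC
  have key : ∑ i, ∑ j, star (f i) ⬝ᵥ (((τ.smulRight (Bᴴ * B)) ((A i)ᴴ * A j)) *ᵥ f j)
      = ∑ k, τ ((∑ j, (B *ᵥ f j) k • A j)ᴴ * (∑ j, (B *ᵥ f j) k • A j)) := by
    have e : ∀ i j, star (f i) ⬝ᵥ (((τ.smulRight (Bᴴ * B)) ((A i)ᴴ * A j)) *ᵥ f j)
        = ∑ k, star ((B *ᵥ f i) k) * (B *ᵥ f j) k * τ ((A i)ᴴ * A j) := by
      intro i j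
      rw [LinearMap.smulRight_apply, smul_mulVec, dotProduct_smul, ← mulVec_mulVec,
        dotProduct_mulVec, ← star_mulVec, dotProduct, smul_eq_mul, Finset.mul_sum]
      refine Finset.sum_congr rfl fun k _ => ?_
      simp only [Pi.star_apply]; ring
    simp_rw [e, conjTranspose_sum, conjTranspose_smul, Finset.sum_mul, Finset.mul_sum, map_sum,
      smul_mul_assoc, mul_smul_comm, map_smul, smul_eq_mul]
    refine (Finset.sum_congr rfl fun i _ => Finset.sum_comm).trans (Finset.sum_comm.trans ?_)
    refine Finset.sum_congr rfl fun k _ => Finset.sum_congr rfl fun i _ =>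
      Finset.sum_congr rfl fun j _ => ?_
    ring
  rw [key]
  exact Finset.sum_nonneg fun k _ => hτpos _ (posSemidef_conjTranspose_mul_self _)

lemma isCP_smul {n : ℕ} (φ : Module.End ℂ (MatC n)) (h : IsCP φ) (r : ℝ) (hr : 0 ≤ r) :
    IsCP ((r : ℂ) • φ) := by
  intro m A f
  have := mul_nonneg (show (0 : ℂ) ≤ r by exact_mod_cast hr) (h m A f)
  simpa [Finset.mul_sum, smul_mulVec, dotProduct_smul] using this

lemma pos_zero {n : ℕ} (f : MatC n →ₗ[ℂ] ℂ) (hf : ∀ A : MatC n, A.PosSemidef → 0 ≤ f A)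
    (h1 : f 1 = 0) : f = 0 := by
  have hsum : ∀ A : MatC n, f A + f Aᴴ = 0 := by
    intro A
    have hb := hf _ (posSemidef_conjTranspose_mul_self A)
    have hq : ∀ e : ℝ, 0 ≤ (e : ℂ) * (f A + f Aᴴ) + (e : ℂ) ^ 2 * f (Aᴴ * A) := by
      intro e
      have := hf _ (posSemidef_conjTranspose_mul_self (1 + (e : ℂ) • A))
      have e2 : (1 + (e : ℂ) • A)ᴴ * (1 + (e : ℂ) • A)
          = 1 + (e : ℂ) • (A + Aᴴ) + ((e : ℂ) ^ 2) • (Aᴴ * A) := by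
        simp only [conjTranspose_add, conjTranspose_smul, conjTranspose_one, add_mul, mul_add,
          one_mul, mul_one, smul_mul_assoc, mul_smul_comm, RCLike.star_def, Complex.conj_ofReal]
        module
      rw [e2] at this
      simpa [h1, mul_add] using this
    set a := f A + f Aᴴ
    set b := f (Aᴴ * A)
    have hbr : 0 ≤ b.re := (Complex.le_def.mp hb).1
    have hbi : 0 = b.im := (Complex.le_def.mp hb).2
    have hi : a.im = 0 := by
      have := (Complex.le_def.mp (hq 1)).2
      simp at this
      linarith
    have hr : ∀ e : ℝ, 0 ≤ e * a.re + e ^ 2 * b.re := by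
      intro e
      have := (Complex.le_def.mp (hq e)).1
      rw [← Complex.ofReal_pow] at this
      simpa only [Complex.add_re, Complex.re_ofReal_mul, Complex.zero_re] using this
    have hre : a.re = 0 := by
      have h3 := hr (-a.re / (b.re + 1))
      have h4 : -a.re / (b.re + 1) * a.re + (-a.re / (b.re + 1)) ^ 2 * b.re
          = - (a.re / (b.re + 1)) ^ 2 := by
        field_simp; ring
      rw [h4] at h3
      have h5 : a.re / (b.re + 1) = 0 := by nlinarith
      have : b.re + 1 ≠ 0 := by positivity
      simpa [this] using h5
    exact Complex.ext hre hi
  ext1 A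
  have h2 := hsum A
  have h3 := hsum (Complex.I • A)
  simp only [conjTranspose_smul, map_smul, smul_eq_mul, RCLike.star_def, Complex.conj_I] at h3
  have : Complex.I * (f A - f Aᴴ) = 0 := by linear_combination h3
  have h4 : f A - f Aᴴ = 0 := by simpa using this
  simp only [LinearMap.zero_apply]
  linear_combination (h2 + h4) / 2

lemma key_ineq {s a b : ℝ} (h : ∀ t : ℝ, 0 ≤ t → 0 ≤ (1 + t)⁻¹ * a - (1 + t * s)⁻¹ * b)
    (hs : 0 ≤ s) : b ≤ s * a := by
  by_contra! hc
  have h' : ∀ t : ℝ, 0 ≤ t → (1 + t) * b ≤ (1 + t * s) * a := by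
    intro t ht
    have h1 := h t ht
    have p1 : 0 < 1 + t := by positivity
    have p2 : 0 < 1 + t * s := by positivity
    have : 0 ≤ ((1 + t) * (1 + t * s)) * ((1 + t)⁻¹ * a - (1 + t * s)⁻¹ * b) := by positivity
    have e : ((1 + t) * (1 + t * s)) * ((1 + t)⁻¹ * a - (1 + t * s)⁻¹ * b)
      = (1 + t * s) * a - (1 + t) * b := by field_simp
    linarith
  have hd : 0 < b - s * a := by linarith
  have h2 := h' ((|a - b| + 1) / (b - s * a)) (by positivity)
  have h3 : (|a - b| + 1) / (b - s * a) * (b - s * a) = |a - b| + 1 := div_mul_cancel₀ _ hd.ne'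
  have := le_abs_self (a - b)
  nlinarith

lemma exists_real {z : ℂ} (h : 0 ≤ z) : ∃ s : ℝ, 0 ≤ s ∧ z = (s : ℂ) := by
  have := Complex.le_def.mp h
  exact ⟨z.re, this.1, Complex.ext rfl (by simpa using this.2.symm)⟩

lemma psd_diff {n : ℕ} (C : MatC n) (hC : C.PosSemidef) (a b : ℝ)
    (h : ∀ v : Fin n → ℂ, b * (star v ⬝ᵥ (C *ᵥ v)).re ≤ a * (star v ⬝ᵥ v).re) :
    ((a : ℂ) • (1 : MatC n) - (b : ℂ) • C).PosSemidef := by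
  refine PosSemidef.of_dotProduct_mulVec_nonneg ?_ ?_
  · unfold Matrix.IsHermitian
    simp [conjTranspose_sub, conjTranspose_smul, hC.isHermitian.eq]
  · intro v
    obtain ⟨x, hx, hx'⟩ := exists_real (hC.dotProduct_mulVec_nonneg v)
    obtain ⟨y, hy, hy'⟩ := exists_real (show 0 ≤ star v ⬝ᵥ v from dotProduct_star_self_nonneg v)
    have := h v
    rw [sub_mulVec, smul_mulVec, smul_mulVec, dotProduct_sub, dotProduct_smul, dotProduct_smul,
      one_mulVec, hx', hy']
    rw [hx', hy'] at this
    simp only [Complex.ofReal_re] at this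
    simp only [smul_eq_mul]
    exact_mod_cast sub_nonneg.mpr this

/-- For a faithful state `ρ` with `φ(A)=ρ(A)I`, a non-zero positive functional `τ` and
a non-zero positive matrix `C` with `ψ(A)=τ(A)C`: `ψ` is q-positive, and `φ ≥_q ψ`
iff `ψ = λφ` for some `λ ∈ (0,1]`. -/
theorem stmt3 {n : ℕ} (ρ τ : MatC n →ₗ[ℂ] ℂ) (C : MatC n)
    (hρpos : ∀ A : MatC n, A.PosSemidef → 0 ≤ ρ A) (hρ1 : ρ 1 = 1)
    (hfaith : ∀ A : MatC n, A.PosSemidef → A ≠ 0 → 0 < ρ A)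
    (hτpos : ∀ A : MatC n, A.PosSemidef → 0 ≤ τ A) (hτne : τ ≠ 0)
    (hC : C.PosSemidef) (hCne : C ≠ 0) :
    IsQPos (τ.smulRight C) ∧
    (qLE (τ.smulRight C) (ρ.smulRight (1 : MatC n)) ↔
      ∃ l : ℝ, 0 < l ∧ l ≤ 1 ∧
        (τ.smulRight C : Module.End ℂ (MatC n))
          = (l : ℂ) • (ρ.smulRight (1 : MatC n) : Module.End ℂ (MatC n))) := by
  obtain ⟨s, hs, hs'⟩ := exists_real (hτpos C hC)
  have hψ := isCP_smulRight τ C hτpos hC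
  refine ⟨⟨?_, ?_⟩, ?_, ?_⟩
  · intro r hr he
    obtain ⟨A, hA⟩ := he.exists_hasEigenvector
    have h1 := hA.apply_eq_smul
    have hA0 := hA.2
    simp only [LinearMap.smulRight_apply] at h1
    have h2 := congrArg τ h1
    simp only [map_smul, smul_eq_mul, hs'] at h2
    have hrne : (r : ℂ) ≠ 0 := by exact_mod_cast hr.ne
    by_cases h0 : τ A = 0
    · rw [h0, zero_smul] at h1
      exact (smul_ne_zero hrne hA0) h1.symm
    · have : (s : ℂ) = r := mul_left_cancel₀ h0 (by linear_combination h2)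
      have : s = r := by exact_mod_cast this
      linarith
  · intro t ht
    rw [qRes_smulRight τ C s hs hs' t ht]
    exact isCP_smul _ hψ _ (by positivity)
  · intro hq
    have hn : Nonempty (Fin n) := by
      by_contra hcon
      rw [not_nonempty_iff] at hcon
      exact hCne (Subsingleton.elim _ _)
    obtain ⟨i0⟩ := hn
    -- the basic family of scalar inequalities
    have base : ∀ A : MatC n, A.PosSemidef → ∀ v : Fin n → ℂ, ∀ t : ℝ, 0 ≤ t →
        0 ≤ (1 + t)⁻¹ * ((ρ A).re * (star v ⬝ᵥ v).re)
          - (1 + t * s)⁻¹ * ((τ A).re * (star v ⬝ᵥ (C *ᵥ v)).re) := by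
      intro A hA v t ht
      obtain ⟨p, hp, hp'⟩ := exists_real (hρpos A hA)
      obtain ⟨q, hq1, hq'⟩ := exists_real (hτpos A hA)
      obtain ⟨x, hx, hx'⟩ := exists_real (hC.dotProduct_mulVec_nonneg v)
      obtain ⟨y, hy, hy'⟩ := exists_real (show 0 ≤ star v ⬝ᵥ v from dotProduct_star_self_nonneg v)
      obtain ⟨B, hB⟩ := psd_factor hA
      have h1 := hq t ht 1 (fun _ => B) (fun _ => v)
      rw [qRes_smulRight τ C s hs hs' t ht,
        qRes_smulRight ρ 1 1 zero_le_one (by simpa using hρ1) t ht] at h1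
      simp only [Finset.univ_unique, Finset.sum_singleton, ← hB, LinearMap.sub_apply,
        LinearMap.smul_apply, LinearMap.smulRight_apply, sub_mulVec, smul_mulVec, dotProduct_sub,
        dotProduct_smul, one_mulVec, hx', hy', hp', hq', smul_eq_mul, mul_one] at h1
      rw [hx', hy', hp', hq']
      simp only [Complex.ofReal_re]
      exact_mod_cast h1
    have lim : ∀ A : MatC n, A.PosSemidef → ∀ v : Fin n → ℂ,
        (τ A).re * (star v ⬝ᵥ (C *ᵥ v)).re ≤ s * ((ρ A).re * (star v ⬝ᵥ v).re) :=
      fun A hA v => key_ineq (base A hA v) hs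
    obtain ⟨w, hw, hw'⟩ := exists_real (hτpos 1 PosSemidef.one)
    have hwne : w ≠ 0 := by
      rintro rfl
      exact hτne (pos_zero τ hτpos (by simpa using hw'))
    have hwpos : 0 < w := lt_of_le_of_ne hw hwne.symm
    obtain ⟨c, hc, hc'⟩ := exists_real (hρpos C hC)
    have hcpos : 0 < c := by
      have := hfaith C hC hCne
      rw [hc'] at this
      exact_mod_cast this
    have hD := psd_diff C hC s w (fun v => by
      have := lim 1 PosSemidef.one v
      rw [hw', hρ1] at this
      simpa using this)
    have hspos : 0 < s := by
      have := hρpos _ hD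
      simp only [map_sub, map_smul, hρ1, hc', smul_eq_mul, mul_one] at this
      have : 0 ≤ s - w * c := by exact_mod_cast this
      nlinarith [mul_pos hwpos hcpos]
    have hE := psd_diff C hC (s * c) s (fun v => by
      have := lim C hC v
      rw [hs', hc'] at this
      simpa [mul_assoc] using this)
    have hE0 : ((s * c : ℝ) : ℂ) • (1 : MatC n) - (s : ℂ) • C = 0 := by
      by_contra hne
      have := hfaith _ hE hne
      simp [hρ1, hc'] at this
    have hCc : C = (c : ℂ) • (1 : MatC n) := by
      have hsne : (s : ℂ) ≠ 0 := by exact_mod_cast hspos.ne'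
      apply smul_right_injective _ hsne
      have := sub_eq_zero.mp hE0
      simp only [smul_smul]
      rw [← this]; push_cast; rfl
    have hsc : s = c * w := by
      have := hs'
      rw [hCc, map_smul, hw', smul_eq_mul] at this
      exact_mod_cast this.symm
    have hv : ∃ v : Fin n → ℂ, star v ⬝ᵥ v = 1 := ⟨Pi.single i0 1, by simp⟩
    obtain ⟨v, hv⟩ := hv
    have hCv : star v ⬝ᵥ (C *ᵥ v) = c := by
      rw [hCc, smul_mulVec, one_mulVec, dotProduct_smul, hv]; simp
    have hf : (s : ℂ) • ρ - (c : ℂ) • τ = 0 := by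
      apply pos_zero
      · intro A hA
        obtain ⟨p, hp, hp'⟩ := exists_real (hρpos A hA)
        obtain ⟨q, hq1, hq'⟩ := exists_real (hτpos A hA)
        have := lim A hA v
        rw [hCv, hv, hp', hq'] at this
        simp only [Complex.ofReal_re, Complex.one_re, mul_one] at this
        simp only [LinearMap.sub_apply, LinearMap.smul_apply, hp', hq', smul_eq_mul]
        have h2 : 0 ≤ s * p - c * q := by linarith
        exact_mod_cast h2
      · simp [hρ1, hw', hsc]
    refine ⟨s, hspos, ?_, ?_⟩
    · have := base 1 PosSemidef.one v 0 le_rfl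
      rw [hCv, hv, hw', hρ1] at this
      simp at this
      linarith
    · ext1 A
      have := LinearMap.congr_fun hf A
      simp only [LinearMap.sub_apply, LinearMap.smul_apply, smul_eq_mul, LinearMap.zero_apply] at this
      simp only [LinearMap.smulRight_apply, LinearMap.smul_apply]
      rw [hCc, smul_smul, smul_smul]
      congr 1
      linear_combination -this
  · rintro ⟨l, hl, hl1, he⟩
    have he2 : (τ.smulRight C : Module.End ℂ (MatC n)) = ((l : ℂ) • ρ).smulRight (1 : MatC n) := by
      rw [he]; ext1 A; simp [smul_smul]
    intro t ht
    rw [he2, qRes_smulRight ρ 1 1 zero_le_one (by simpa using hρ1) t ht,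
      qRes_smulRight ((l : ℂ) • ρ) 1 l hl.le (by simp [hρ1]) t ht, ← he2, he, smul_smul]
    have h1 := isCP_smul _ (isCP_smulRight ρ 1 hρpos PosSemidef.one)
      ((1 + t * 1)⁻¹ - (1 + t * l)⁻¹ * l) (by
        have p2 : 0 < 1 + t * l := by positivity
        have e : (1 + t * 1)⁻¹ - (1 + t * l)⁻¹ * l = (1 - l) / ((1 + t) * (1 + t * l)) := by
          field_simp; ring
        rw [e]
        have : 0 ≤ 1 - l := by linarith
        positivity)
    convert h1 using 1
    push_cast
    module
end

section
/- Let ρ be a state on Mₙ(ℂ) and define the q-positive map φ(A) = ρ(A)·I. Then φ is q-pure if and only if ρ is faithful. -/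
open scoped ComplexOrder BigOperators
open Matrix

/-! ### Basic facts about completely positive maps -/

lemma sub5_cp_two {n : ℕ} (T : Module.End ℂ (MatC n)) (A : MatC n) (f g : Fin n → ℂ) (c : ℂ) :
    ∑ i, ∑ j, star ((![c • f, g] : Fin 2 → (Fin n → ℂ)) i) ⬝ᵥ
      ((T (((![1, A] : Fin 2 → MatC n) i)ᴴ * (![1, A] : Fin 2 → MatC n) j)) *ᵥ
        (![c • f, g] : Fin 2 → (Fin n → ℂ)) j)
    = star c * c * (star f ⬝ᵥ (T 1 *ᵥ f)) + star c * (star f ⬝ᵥ (T A *ᵥ g))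
      + c * (star g ⬝ᵥ (T Aᴴ *ᵥ f)) + star g ⬝ᵥ (T (Aᴴ * A) *ᵥ g) := by
  simp [Fin.sum_univ_two, Matrix.mulVec_smul]
  ring

lemma sub5_ext {n : ℕ} (M : MatC n) (h : ∀ f g : Fin n → ℂ, star f ⬝ᵥ (M *ᵥ g) = 0) : M = 0 := by
  ext i j
  have := h (Pi.single i 1) (Pi.single j 1)
  have hs : star (Pi.single i 1 : Fin n → ℂ) = Pi.single i 1 := by
    ext k; by_cases hk : k = i
    · subst hk; simp
    · simp [hk]
  rw [hs] at this
  simpa using this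

/-- A CP map vanishing at `1` is zero. -/
lemma sub5_cp_zero {n : ℕ} (T : Module.End ℂ (MatC n)) (hT : IsCP T) (h1 : T 1 = 0) : T = 0 := by
  apply LinearMap.ext
  intro A
  rw [LinearMap.zero_apply]
  apply sub5_ext
  intro f g
  set z := star f ⬝ᵥ (T A *ᵥ g) with hz
  set w := star g ⬝ᵥ (T Aᴴ *ᵥ f) with hw
  set k := star g ⬝ᵥ (T (Aᴴ * A) *ᵥ g) with hk
  have key : ∀ c : ℂ, 0 ≤ star c * z + c * w + k := by
    intro c
    have := hT 2 ![1, A] ![c • f, g]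
    rw [sub5_cp_two, h1] at this
    simpa using this
  have lin : ∀ u : ℂ, (∀ r : ℝ, 0 ≤ r * u + k) → u = 0 := by
    intro u hu
    have a0 := Complex.le_def.1 (hu 0)
    have a1 := Complex.le_def.1 (hu 1)
    simp at a0 a1
    have him : u.im = 0 := by linarith [a0.2, a1.2]
    have hre : u.re = 0 := by
      by_contra hne
      have := (Complex.le_def.1 (hu (-(k.re + 1) / u.re))).1
      simp only [Complex.zero_re, Complex.add_re, Complex.re_ofReal_mul] at this
      rw [div_mul_cancel₀ _ hne] at this
      linarith
    exact Complex.ext hre him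
  have e1 : z + w = 0 := by
    apply lin
    intro r
    have := key r
    simp at this
    rw [mul_add]; exact this
  have e2 : -Complex.I * z + Complex.I * w = 0 := by
    apply lin
    intro r
    have := key (r * Complex.I)
    simp at this
    convert this using 1
    ring
  have e3 : Complex.I * (w - z) = 0 := by linear_combination e2
  have e4 : w - z = 0 := by simpa using e3
  linear_combination (1/2 : ℂ) * e1 - (1/2 : ℂ) * e4

open scoped MatrixOrder Matrix.Norms.L2Operator in
lemma sub5_sqrt {n : ℕ} {A : MatC n} (hA : A.PosSemidef) : ∃ B : MatC n, A = Bᴴ * B :=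
  CStarAlgebra.nonneg_iff_eq_star_mul_self.mp hA.nonneg

/-- CP maps are positive. -/
lemma sub5_cp_pos {n : ℕ} {T : Module.End ℂ (MatC n)} (hT : IsCP T) {A : MatC n}
    (hA : A.PosSemidef) : (T A).PosSemidef := by
  obtain ⟨B, rfl⟩ := sub5_sqrt hA
  have h : ∀ f : Fin n → ℂ, 0 ≤ star f ⬝ᵥ (T (Bᴴ * B) *ᵥ f) := by
    intro f
    simpa using hT 1 ![B] ![f]
  rw [Matrix.posSemidef_iff_dotProduct_mulVec]
  refine ⟨?_, h⟩
  rw [Matrix.isHermitian_iff_isSymmetric, LinearMap.isSymmetric_iff_inner_map_self_real]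
  intro v
  have := h v.ofLp
  have h2 := Complex.conj_eq_iff_im.2 (Complex.le_def.1 this).2.symm
  have h3 : inner ℂ v ((T (Bᴴ * B)).toEuclideanLin v) = star v.ofLp ⬝ᵥ (T (Bᴴ * B) *ᵥ v.ofLp) := by
    rw [EuclideanSpace.inner_eq_star_dotProduct, dotProduct_comm]
    rfl
  rw [← inner_conj_symm, h3, h2, h2]

lemma sub5_cp_smul {n : ℕ} {T : Module.End ℂ (MatC n)} (hT : IsCP T) {a : ℝ} (ha : 0 ≤ a) :
    IsCP ((a : ℂ) • T) := by
  intro m A f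
  have := hT m A f
  have e : ∑ i, ∑ j, star (f i) ⬝ᵥ ((((a : ℂ) • T) ((A i)ᴴ * A j)) *ᵥ f j)
      = a * ∑ i, ∑ j, star (f i) ⬝ᵥ ((T ((A i)ᴴ * A j)) *ᵥ f j) := by
    simp only [LinearMap.smul_apply, Matrix.smul_mulVec, dotProduct_smul, smul_eq_mul,
      Finset.mul_sum]
  rw [e]
  exact mul_nonneg (by exact_mod_cast ha) this

/-- Pointwise limits of CP maps are CP. -/
lemma sub5_cp_lim {n : ℕ} {T : ℝ → Module.End ℂ (MatC n)} {L : Module.End ℂ (MatC n)}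
    (hT : ∀ t, 0 ≤ t → IsCP (T t))
    (hL : ∀ A, Filter.Tendsto (fun t => T t A) Filter.atTop (nhds (L A))) : IsCP L := by
  intro m A f
  refine ge_of_tendsto (x := Filter.atTop) (f := fun t : ℝ =>
    ∑ i, ∑ j, star (f i) ⬝ᵥ ((T t ((A i)ᴴ * A j)) *ᵥ f j)) ?_ ?_
  · refine tendsto_finsetSum _ fun i _ => tendsto_finsetSum _ fun j _ => ?_
    have hc : Continuous fun M : MatC n => star (f i) ⬝ᵥ (M *ᵥ f j) := by fun_prop
    exact (hc.tendsto _).comp (hL _)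
  · filter_upwards [Filter.eventually_ge_atTop 0] with t ht
    exact hT t ht m A f

/-- CP maps dominated by a null family tend to zero. -/
lemma sub5_lim_zero {n : ℕ} {T : ℝ → Module.End ℂ (MatC n)} {φ : Module.End ℂ (MatC n)}
    (hT : ∀ t, 0 ≤ t → IsCP (T t))
    (hφ : ∀ t : ℝ, 0 ≤ t → IsCP (((1 / (1 + t) : ℝ) : ℂ) • φ - T t)) (A : MatC n) :
    Filter.Tendsto (fun t => T t A) Filter.atTop (nhds 0) := by
  have hlim : Filter.Tendsto (fun t : ℝ => ((1 / (1 + t) : ℝ) : ℂ)) Filter.atTop (nhds 0) := by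
    have : Filter.Tendsto (fun t : ℝ => 1 / (1 + t)) Filter.atTop (nhds 0) := by
      simp only [one_div]
      exact tendsto_inv_atTop_zero.comp (Filter.tendsto_atTop_add_const_left _ _ Filter.tendsto_id)
    exact_mod_cast (Complex.continuous_ofReal.tendsto 0).comp this
  have hfg : ∀ f g : Fin n → ℂ, Filter.Tendsto (fun t => star f ⬝ᵥ (T t A *ᵥ g)) Filter.atTop
      (nhds 0) := by
    intro f g
    have hq : ∀ c : ℂ, Filter.Tendsto (fun t => star c * c * (star f ⬝ᵥ (T t 1 *ᵥ f))
        + star c * (star f ⬝ᵥ (T t A *ᵥ g))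
        + c * (star g ⬝ᵥ (T t Aᴴ *ᵥ f)) + star g ⬝ᵥ (T t (Aᴴ * A) *ᵥ g)) Filter.atTop
        (nhds 0) := by
      intro c
      have hup := hlim.mul_const (star c * c * (star f ⬝ᵥ (φ 1 *ᵥ f))
        + star c * (star f ⬝ᵥ (φ A *ᵥ g))
        + c * (star g ⬝ᵥ (φ Aᴴ *ᵥ f)) + star g ⬝ᵥ (φ (Aᴴ * A) *ᵥ g))
      rw [zero_mul] at hup
      have h0 : ∀ᶠ t : ℝ in Filter.atTop, 0 ≤ t := Filter.eventually_ge_atTop 0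
      have lo : ∀ t : ℝ, 0 ≤ t → 0 ≤ star c * c * (star f ⬝ᵥ (T t 1 *ᵥ f))
        + star c * (star f ⬝ᵥ (T t A *ᵥ g))
        + c * (star g ⬝ᵥ (T t Aᴴ *ᵥ f)) + star g ⬝ᵥ (T t (Aᴴ * A) *ᵥ g) := by
        intro t ht
        have := hT t ht 2 ![1, A] ![c • f, g]
        rwa [sub5_cp_two] at this
      have up : ∀ t : ℝ, 0 ≤ t → star c * c * (star f ⬝ᵥ (T t 1 *ᵥ f))
        + star c * (star f ⬝ᵥ (T t A *ᵥ g))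
        + c * (star g ⬝ᵥ (T t Aᴴ *ᵥ f)) + star g ⬝ᵥ (T t (Aᴴ * A) *ᵥ g) ≤
        ((1 / (1 + t) : ℝ) : ℂ) * (star c * c * (star f ⬝ᵥ (φ 1 *ᵥ f))
        + star c * (star f ⬝ᵥ (φ A *ᵥ g))
        + c * (star g ⬝ᵥ (φ Aᴴ *ᵥ f)) + star g ⬝ᵥ (φ (Aᴴ * A) *ᵥ g)) := by
        intro t ht
        have := hφ t ht 2 ![1, A] ![c • f, g]
        rw [sub5_cp_two] at this
        rw [← sub_nonneg]
        convert this using 1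
        simp only [LinearMap.sub_apply, LinearMap.smul_apply, Matrix.sub_mulVec,
          Matrix.smul_mulVec, dotProduct_sub, dotProduct_smul, smul_eq_mul]
        ring
      have hre := Complex.continuous_re.tendsto 0 |>.comp hup
      have r1 : Filter.Tendsto (fun t => (star c * c * (star f ⬝ᵥ (T t 1 *ᵥ f))
        + star c * (star f ⬝ᵥ (T t A *ᵥ g))
        + c * (star g ⬝ᵥ (T t Aᴴ *ᵥ f)) + star g ⬝ᵥ (T t (Aᴴ * A) *ᵥ g)).re) Filter.atTop
        (nhds 0) := by
        refine tendsto_of_tendsto_of_tendsto_of_le_of_le' tendsto_const_nhds hre ?_ ?_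
        · filter_upwards [h0] with t ht
          exact (Complex.le_def.1 (lo t ht)).1
        · filter_upwards [h0] with t ht
          exact (Complex.le_def.1 (up t ht)).1
      have r2 := (Complex.continuous_ofReal.tendsto 0).comp r1
      rw [Complex.ofReal_zero] at r2
      refine r2.congr' ?_
      filter_upwards [h0] with t ht
      apply Complex.ext
      · simp only [Function.comp, Complex.ofReal_re]
      · rw [← (Complex.le_def.1 (lo t ht)).2]; simp only [Function.comp, Complex.ofReal_im, Complex.zero_im]
    have hsum := (((hq 1).sub (hq (-1))).add (((hq Complex.I).sub (hq (-Complex.I))).const_mul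
      Complex.I)).const_mul (1/4 : ℂ)
    simp only [sub_zero, mul_zero, add_zero] at hsum
    refine hsum.congr fun t => ?_
    simp only [star_one, star_neg, RCLike.star_def, Complex.conj_I]
    linear_combination (-1/2 * (star f ⬝ᵥ (T t A *ᵥ g)) + 1/2 * (star g ⬝ᵥ (T t Aᴴ *ᵥ f))) * Complex.I_sq
  refine tendsto_pi_nhds.2 fun i => tendsto_pi_nhds.2 fun j => ?_
  have := hfg (Pi.single i 1) (Pi.single j 1)
  have hs : star (Pi.single i 1 : Fin n → ℂ) = Pi.single i 1 := by
    ext k; by_cases hk : k = i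
    · subst hk; simp
    · simp [hk]
  rw [hs] at this
  simpa using this

/-! ### Resolvents -/

lemma sub5_isUnit {n : ℕ} {ψ : Module.End ℂ (MatC n)} (h : NoNegEig ψ) {t : ℝ} (ht : 0 ≤ t) :
    IsUnit (1 + (t : ℂ) • ψ) := by
  rw [LinearMap.isUnit_iff_ker_eq_bot, LinearMap.ker_eq_bot']
  intro x hx
  rcases ht.eq_or_lt with rfl | ht
  · simpa using hx
  by_contra hne
  apply h (-1 / t) (div_neg_of_neg_of_pos (by norm_num) ht)
  apply Module.End.hasEigenvalue_of_hasEigenvector (x := x)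
  rw [Module.End.hasEigenvector_iff, Module.End.mem_eigenspace_iff]
  refine ⟨?_, hne⟩
  have htc : (t : ℂ) ≠ 0 := by exact_mod_cast ht.ne'
  simp at hx
  have h2 : (t : ℂ) • ψ x = -x := by rw [eq_neg_iff_add_eq_zero, add_comm]; exact hx
  have h3 : ψ x = (t : ℂ)⁻¹ • (-x) := by rw [← h2, smul_smul, inv_mul_cancel₀ htc, one_smul]
  rw [h3]; push_cast; rw [smul_neg, ← neg_smul]; congr 1; ring

lemma sub5_qRes_mul {n : ℕ} {ψ : Module.End ℂ (MatC n)} (h : NoNegEig ψ) {t : ℝ} (ht : 0 ≤ t) :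
    qRes ψ t * (1 + (t : ℂ) • ψ) = ψ := by
  rw [qRes, mul_assoc, Ring.inverse_mul_cancel _ (sub5_isUnit h ht), mul_one]

lemma sub5_qRes_apply {n : ℕ} {ψ : Module.End ℂ (MatC n)} (h : NoNegEig ψ) {t : ℝ} (ht : 0 ≤ t)
    (x : MatC n) : qRes ψ t x + (t : ℂ) • qRes ψ t (ψ x) = ψ x := by
  have := congrArg (fun T : Module.End ℂ (MatC n) => T x) (sub5_qRes_mul h ht)
  simpa using this

lemma sub5_qRes_eq {n : ℕ} {ψ S : Module.End ℂ (MatC n)} (h : NoNegEig ψ) {t : ℝ} (ht : 0 ≤ t)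
    (hS : S * (1 + (t : ℂ) • ψ) = ψ) : qRes ψ t = S := by
  rw [← (sub5_isUnit h ht).mul_left_inj, sub5_qRes_mul h ht, hS]

/-! ### The rank one maps `A ↦ ρ(A) E` -/

lemma sub5_noNeg {n : ℕ} (ρ : MatC n →ₗ[ℂ] ℂ) {E : MatC n} (hE : ρ E = 1) {c : ℝ} (hc : 0 ≤ c) :
    NoNegEig ((c : ℂ) • (ρ.smulRight E : Module.End ℂ (MatC n))) := by
  intro r hr hev
  obtain ⟨x, hx⟩ := hev.exists_hasEigenvector
  rw [Module.End.hasEigenvector_iff, Module.End.mem_eigenspace_iff] at hx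
  obtain ⟨hx, hne⟩ := hx
  simp at hx
  have h1 := congrArg ρ hx
  simp [hE] at h1
  rcases h1 with h1 | h1
  · have : c = r := by exact_mod_cast h1
    linarith
  · rw [h1] at hx
    rw [zero_smul, smul_zero] at hx
    exact hne ((smul_eq_zero.1 hx.symm).resolve_left hr.ne)

lemma sub5_qRes_rank {n : ℕ} (ρ : MatC n →ₗ[ℂ] ℂ) {E : MatC n} (hE : ρ E = 1) {c t : ℝ}
    (hc : 0 ≤ c) (ht : 0 ≤ t) :
    qRes ((c : ℂ) • (ρ.smulRight E : Module.End ℂ (MatC n))) t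
      = ((c / (1 + t * c) : ℝ) : ℂ) • (ρ.smulRight E : Module.End ℂ (MatC n)) := by
  apply sub5_qRes_eq (sub5_noNeg ρ hE hc) ht
  apply LinearMap.ext
  intro x
  have hd : (1 + t * c : ℂ) ≠ 0 := by
    have : 0 < 1 + t * c := by positivity
    exact_mod_cast this.ne'
  simp [hE, smul_smul, ← add_smul]
  congr 1
  field_simp

lemma sub5_cp_rank {n : ℕ} (ρ : MatC n →ₗ[ℂ] ℂ)
    (hpos : ∀ A : MatC n, A.PosSemidef → 0 ≤ ρ A) {E : MatC n} (hE : E.PosSemidef) :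
    IsCP (ρ.smulRight E : Module.End ℂ (MatC n)) := by
  obtain ⟨C, rfl⟩ := sub5_sqrt hE
  intro m A f
  have e : ∑ i, ∑ j, star (f i) ⬝ᵥ (((ρ.smulRight (Cᴴ * C) : Module.End ℂ (MatC n))
      ((A i)ᴴ * A j)) *ᵥ f j)
      = ∑ k, ρ ((∑ i, (C *ᵥ f i) k • A i)ᴴ * (∑ j, (C *ᵥ f j) k • A j)) := by
    simp only [Matrix.conjTranspose_sum, Finset.sum_mul, Finset.mul_sum, map_sum,
      Matrix.conjTranspose_smul, Matrix.smul_mul, Matrix.mul_smul, map_smul, smul_eq_mul]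
    have hR : ∀ F : Fin n → Fin m → Fin m → ℂ,
        ∑ k, ∑ i, ∑ j, F k i j = ∑ j, ∑ i, ∑ k, F k i j := by
      intro F
      rw [Finset.sum_comm]
      rw [Finset.sum_comm (s := (Finset.univ : Finset (Fin m)))
        (t := (Finset.univ : Finset (Fin m)))]
      refine Finset.sum_congr rfl fun i _ => ?_
      rw [Finset.sum_comm]
    rw [hR]
    refine Finset.sum_congr rfl fun i _ => Finset.sum_congr rfl fun j _ => ?_
    have hd : star (f i) ⬝ᵥ ((Cᴴ * C) *ᵥ f j) = ∑ k, star ((C *ᵥ f i) k) * (C *ᵥ f j) k := by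
      rw [← Matrix.mulVec_mulVec, Matrix.dotProduct_mulVec, ← Matrix.star_mulVec]
      rfl
    rw [LinearMap.smulRight_apply, Matrix.smul_mulVec, dotProduct_smul, hd, smul_eq_mul,
      Finset.mul_sum]
    refine Finset.sum_congr rfl fun k _ => ?_
    ring
  rw [e]
  exact Finset.sum_nonneg fun k _ => hpos _ (Matrix.posSemidef_conjTranspose_mul_self _)

lemma sub5_qpos_rank {n : ℕ} (ρ : MatC n →ₗ[ℂ] ℂ)
    (hpos : ∀ A : MatC n, A.PosSemidef → 0 ≤ ρ A) {E : MatC n} (hE : E.PosSemidef)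
    (hE1 : ρ E = 1) {c : ℝ} (hc : 0 ≤ c) :
    IsQPos ((c : ℂ) • (ρ.smulRight E : Module.End ℂ (MatC n))) := by
  refine ⟨sub5_noNeg ρ hE1 hc, fun t ht => ?_⟩
  rw [sub5_qRes_rank ρ hE1 hc ht]
  exact sub5_cp_smul (sub5_cp_rank ρ hpos hE) (by positivity)

lemma sub5_qRes_phi {n : ℕ} (ρ : MatC n →ₗ[ℂ] ℂ) {E : MatC n} (hE1 : ρ E = 1) {t : ℝ}
    (ht : 0 ≤ t) : qRes (ρ.smulRight E : Module.End ℂ (MatC n)) t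
      = ((1 / (1 + t) : ℝ) : ℂ) • (ρ.smulRight E : Module.End ℂ (MatC n)) := by
  have := sub5_qRes_rank ρ hE1 (c := 1) zero_le_one ht
  simpa using this

lemma sub5_sub {n : ℕ} (ρ : MatC n →ₗ[ℂ] ℂ)
    (hpos : ∀ A : MatC n, A.PosSemidef → 0 ≤ ρ A) (hone : ρ 1 = 1) (ψ : Module.End ℂ (MatC n))
    (h : ψ = 0 ∨ ∃ s : ℝ, 0 ≤ s ∧ ψ = qRes (ρ.smulRight (1 : MatC n)) s) :
    IsQPos ψ ∧ qLE ψ (ρ.smulRight (1 : MatC n)) := by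
  obtain ⟨c, hc, hc1, rfl⟩ : ∃ c : ℝ, 0 ≤ c ∧ c ≤ 1 ∧
      ψ = (c : ℂ) • (ρ.smulRight 1 : Module.End ℂ (MatC n)) := by
    rcases h with rfl | ⟨s, hs, rfl⟩
    · exact ⟨0, le_rfl, zero_le_one, by simp⟩
    · refine ⟨1 / (1 + s), by positivity, ?_, sub5_qRes_phi ρ hone hs⟩
      rw [div_le_one (by positivity)]; linarith
  refine ⟨sub5_qpos_rank ρ hpos Matrix.PosSemidef.one hone hc, fun t ht => ?_⟩
  rw [sub5_qRes_phi ρ hone ht, sub5_qRes_rank ρ hone hc ht]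
  have e : ((1 / (1 + t) : ℝ) : ℂ) • (ρ.smulRight 1 : Module.End ℂ (MatC n))
      - ((c / (1 + t * c) : ℝ) : ℂ) • (ρ.smulRight 1 : Module.End ℂ (MatC n))
      = ((1 / (1 + t) - c / (1 + t * c) : ℝ) : ℂ) • (ρ.smulRight 1 : Module.End ℂ (MatC n)) := by
    rw [Complex.ofReal_sub]
    exact (sub_smul _ _ _).symm
  rw [e]
  refine sub5_cp_smul (sub5_cp_rank ρ hpos Matrix.PosSemidef.one) ?_
  rw [sub_nonneg, div_le_div_iff₀ (by positivity) (by positivity)]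
  nlinarith

open scoped MatrixOrder Matrix.Norms.L2Operator in
lemma sub5_bound {n : ℕ} {A : MatC n} (hA : A.PosSemidef) :
    ∃ ε : ℝ, 0 < ε ∧ (1 - (ε : ℂ) • A).PosSemidef := by
  have h := IsSelfAdjoint.le_algebraMap_norm_self (a := A) hA.1
  rw [Matrix.le_iff] at h
  have hp : 0 < ‖A‖ + 1 := by positivity
  refine ⟨1 / (‖A‖ + 1), by positivity, ?_⟩
  have h2 : ((algebraMap ℝ (MatC n) ‖A‖ - A) + 1).PosSemidef := h.add Matrix.PosSemidef.one
  have h3 := h2.smul (a := ((1 / (‖A‖ + 1) : ℝ) : ℂ)) (by exact_mod_cast (by positivity))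
  convert h3 using 1
  have hpc : ((‖A‖ : ℂ) + 1) ≠ 0 := by exact_mod_cast hp.ne'
  have e : algebraMap ℝ (MatC n) ‖A‖ = (‖A‖ : ℂ) • (1 : MatC n) := by
    rw [Algebra.algebraMap_eq_smul_one]; exact (Complex.coe_smul _ _).symm
  have e2 : algebraMap ℝ (MatC n) ‖A‖ - A + 1 = ((‖A‖ : ℂ) + 1) • (1 : MatC n) - A := by
    rw [e, add_smul, one_smul]; abel
  rw [e2, smul_sub, smul_smul]
  push_cast
  rw [one_div_mul_cancel hpc, one_smul]

lemma sub5_forward {n : ℕ} (ρ : MatC n →ₗ[ℂ] ℂ)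
    (hpos : ∀ A : MatC n, A.PosSemidef → 0 ≤ ρ A) (hone : ρ 1 = 1)
    (hq : IsQPure (ρ.smulRight (1 : MatC n))) (A : MatC n) (hA : A.PosSemidef) (hA0 : A ≠ 0) :
    0 < ρ A := by
  by_contra hlt
  have hρ : ρ A = 0 := by
    by_contra hne
    exact hlt (lt_of_le_of_ne (hpos A hA) (Ne.symm hne))
  obtain ⟨ε, hε, hE⟩ := sub5_bound hA
  have hεc : (ε : ℂ) ≠ 0 := by exact_mod_cast hε.ne'
  set E := 1 - (ε : ℂ) • A with hEdef
  have hE1 : ρ E = 1 := by simp [hEdef, hρ, hone]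
  have hsub : IsQPos (ρ.smulRight E : Module.End ℂ (MatC n)) ∧
      qLE (ρ.smulRight E) (ρ.smulRight (1 : MatC n)) := by
    constructor
    · simpa using sub5_qpos_rank ρ hpos hE hE1 (c := 1) zero_le_one
    · intro t ht
      rw [sub5_qRes_phi ρ hone ht, sub5_qRes_phi ρ hE1 ht]
      have e0 : ((1 / (1 + t) : ℝ) : ℂ) • (ρ.smulRight 1 : Module.End ℂ (MatC n))
          - ((1 / (1 + t) : ℝ) : ℂ) • (ρ.smulRight E : Module.End ℂ (MatC n))
          = ((1 / (1 + t) : ℝ) : ℂ) • (ρ.smulRight 1 - ρ.smulRight E : Module.End ℂ (MatC n)) :=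
        (smul_sub _ _ _).symm
      rw [e0]
      refine sub5_cp_smul ?_ (by positivity)
      have e : (ρ.smulRight (1 : MatC n) - ρ.smulRight E : Module.End ℂ (MatC n))
          = ρ.smulRight ((ε : ℂ) • A) := by
        apply LinearMap.ext
        intro x
        simp [hEdef, smul_sub]
      rw [e]
      exact sub5_cp_rank ρ hpos (hA.smul (by exact_mod_cast hε.le))
  rcases (hq.2 _).1 hsub with h0 | ⟨s, hs, h⟩
  · have := congrArg (fun T : Module.End ℂ (MatC n) => ρ (T 1)) h0
    simp [hone, hE1] at this
  · rw [sub5_qRes_phi ρ hone hs] at h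
    have h1 := congrArg (fun T : Module.End ℂ (MatC n) => T 1) h
    simp only [LinearMap.smul_apply, LinearMap.smulRight_apply, hone, one_smul] at h1
    have h2 := congrArg ρ h1
    rw [hE1, map_smul, hone, smul_eq_mul, mul_one] at h2
    rw [← h2, one_smul, hEdef, sub_eq_self] at h1
    exact hA0 ((smul_eq_zero.1 h1).resolve_left hεc)

lemma sub5_backward {n : ℕ} (ρ : MatC n →ₗ[ℂ] ℂ)
    (hpos : ∀ A : MatC n, A.PosSemidef → 0 ≤ ρ A) (hone : ρ 1 = 1)
    (hf : ∀ A : MatC n, A.PosSemidef → A ≠ 0 → 0 < ρ A)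
    (ψ : Module.End ℂ (MatC n)) (hψ : IsQPos ψ) (hle : qLE ψ (ρ.smulRight (1 : MatC n)))
    (hψ0 : ψ ≠ 0) : ∃ s : ℝ, 0 ≤ s ∧ ψ = qRes (ρ.smulRight (1 : MatC n)) s := by
  set φ : Module.End ℂ (MatC n) := ρ.smulRight (1 : MatC n) with hφ
  have φa : ∀ A, φ A = ρ A • (1 : MatC n) := fun A => rfl
  have hle' : ∀ t : ℝ, 0 ≤ t → IsCP (((1 / (1 + t) : ℝ) : ℂ) • φ - qRes ψ t) := by
    intro t ht
    have := hle t ht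
    rwa [sub5_qRes_phi ρ hone ht] at this
  have hz := sub5_lim_zero hψ.2 hle'
  have hker : ∀ t : ℝ, 0 ≤ t → ∀ x, ψ x = 0 → qRes ψ t x = 0 := by
    intro t ht x hx
    simpa [hx] using sub5_qRes_apply hψ.1 ht x
  have hdisj : Disjoint (LinearMap.range ψ) (LinearMap.ker ψ) := by
    rw [Submodule.disjoint_def]
    rintro x ⟨y, rfl⟩ hx
    rw [LinearMap.mem_ker] at hx
    refine tendsto_nhds_unique (f := fun t : ℝ => qRes ψ t y) (l := Filter.atTop) ?_ (hz y)
    refine tendsto_const_nhds.congr' ?_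
    filter_upwards [Filter.eventually_ge_atTop 0] with t ht
    have := sub5_qRes_apply hψ.1 ht y
    rw [hker t ht _ hx] at this
    simpa using this.symm
  have hcompl : IsCompl (LinearMap.range ψ) (LinearMap.ker ψ) :=
    (Submodule.isCompl_iff_disjoint _ _ (LinearMap.finrank_range_add_finrank_ker ψ).ge).2 hdisj
  obtain ⟨L, hLr, hLk, hLm⟩ : ∃ L : Module.End ℂ (MatC n), (∀ y, L (ψ y) = ψ y) ∧
      (∀ x, ψ x = 0 → L x = 0) ∧ (∀ x, ∃ y, L x = ψ y) := by
    refine ⟨Submodule.projection _ _ hcompl, fun y => ?_, fun x hx => ?_, fun x => ?_⟩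
    · exact Submodule.projection_apply_of_mem_left hcompl ⟨y, rfl⟩
    · exact Submodule.projection_apply_of_mem_right hcompl hx
    · obtain ⟨y, hy⟩ := Submodule.projection_apply_mem hcompl x
      exact ⟨y, hy.symm⟩
  have hdec : ∀ x, ∃ y k, ψ k = 0 ∧ x = ψ y + k := by
    intro x
    obtain ⟨y, hy⟩ := hLm x
    obtain ⟨a, ha, b, hb, hab⟩ := Submodule.mem_sup.1
      (hcompl.sup_eq_top ▸ Submodule.mem_top : x ∈ LinearMap.range ψ ⊔ LinearMap.ker ψ)
    obtain ⟨y, rfl⟩ := ha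
    exact ⟨y, b, hb, hab.symm⟩
  have hlim : ∀ x, Filter.Tendsto (fun t : ℝ => ((t : ℂ) • qRes ψ t) x) Filter.atTop
      (nhds (L x)) := by
    intro x
    obtain ⟨y, k, hk, rfl⟩ := hdec x
    rw [map_add, hLr, hLk k hk, add_zero]
    have := (tendsto_const_nhds (x := ψ y)).sub (hz y)
    rw [sub_zero] at this
    refine this.congr' ?_
    filter_upwards [Filter.eventually_ge_atTop 0] with t ht
    rw [LinearMap.smul_apply, map_add, hker t ht k hk, add_zero]
    rw [sub_eq_iff_eq_add, add_comm]
    exact (sub5_qRes_apply hψ.1 ht y).symm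
  have hLcp : IsCP L := sub5_cp_lim (fun t ht => sub5_cp_smul (hψ.2 t ht) ht) hlim
  have hφL : IsCP (φ - L) := by
    refine sub5_cp_lim (T := fun t : ℝ => (t : ℂ) • (((1 / (1 + t) : ℝ) : ℂ) • φ - qRes ψ t))
      (fun t ht => sub5_cp_smul (hle' t ht) ht) fun x => ?_
    have h1 : Filter.Tendsto (fun t : ℝ => ((1 - 1 / (1 + t) : ℝ) : ℂ)) Filter.atTop (nhds 1) := by
      have : Filter.Tendsto (fun t : ℝ => 1 / (1 + t)) Filter.atTop (nhds 0) := by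
        simp only [one_div]
        exact tendsto_inv_atTop_zero.comp
          (Filter.tendsto_atTop_add_const_left _ _ Filter.tendsto_id)
      have h2 := this.const_sub 1
      rw [sub_zero] at h2
      exact_mod_cast (Complex.continuous_ofReal.tendsto 1).comp h2
    have h2 := (h1.smul_const (φ x)).sub (hlim x)
    rw [one_smul] at h2
    refine h2.congr' ?_
    filter_upwards [Filter.eventually_ge_atTop 0] with t ht
    simp only [LinearMap.smul_apply, LinearMap.sub_apply, smul_sub, smul_smul]
    congr 2
    rw [← Complex.ofReal_mul]
    congr 1
    field_simp
    ring
  have hL0 : L ≠ 0 := by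
    intro h
    apply hψ0
    apply LinearMap.ext
    intro y
    rw [← hLr y, h]; rfl
  set E := L 1 with hE
  have hE0 : E ≠ 0 := fun h => hL0 (sub5_cp_zero L hLcp h)
  have hEps : E.PosSemidef := sub5_cp_pos hLcp Matrix.PosSemidef.one
  have hLE : L E = E := by
    obtain ⟨y, hy⟩ := hLm 1
    rw [hE, hy, hLr]
  have h1E : (1 - E).PosSemidef := by
    have := sub5_cp_pos hφL (Matrix.PosSemidef.one)
    simpa [φa, hone] using this
  have hb : (ρ E • (1 : MatC n) - E).PosSemidef := by
    have := sub5_cp_pos hφL hEps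
    simpa [φa, hLE] using this
  have hb2 : ((ρ E - 1) • E).PosSemidef := by
    have := sub5_cp_pos hLcp hb
    rw [map_sub, map_smul, hLE] at this
    rwa [sub_smul, one_smul]
  have hρE : 1 ≤ ρ E := by
    have h1 := hpos _ hb2
    have h2 := hf _ hEps hE0
    rw [map_smul, smul_eq_mul] at h1
    rw [← sub_nonneg]
    exact le_of_mul_le_mul_right (by simpa using h1) h2
  have hE1 : E = 1 := by
    by_contra hne
    have := hf _ h1E (fun h => hne (sub_eq_zero.1 h).symm)
    rw [map_sub, hone] at this
    exact absurd hρE (not_le_of_gt (sub_pos.1 this))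
  have hLφ : φ = L := by
    rw [← sub_eq_zero]
    apply sub5_cp_zero _ hφL
    rw [LinearMap.sub_apply, ← hE, hE1, φa, hone, one_smul, sub_self]
  have hψL : ∀ x, ψ x = ρ x • ψ 1 := by
    intro x
    rw [← map_smul, ← φa, hLφ]
    obtain ⟨y, k, hk, rfl⟩ := hdec x
    rw [map_add L, hLr, hLk k hk, add_zero, map_add, hk, add_zero]
  have hψ1 : ψ 1 = ρ (ψ 1) • (1 : MatC n) := by
    rw [← φa, hLφ, hLr]
  have hq0 : qRes ψ 0 = ψ := by simp [qRes]
  have hψcp : IsCP ψ := by simpa [hq0] using hψ.2 0 le_rfl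
  have hφψ : IsCP (φ - ψ) := by simpa [hq0] using hle' 0 le_rfl
  have hc0 : 0 ≤ ρ (ψ 1) := hpos _ (sub5_cp_pos hψcp Matrix.PosSemidef.one)
  have hc1 : ρ (ψ 1) ≤ 1 := by
    have := hpos _ (sub5_cp_pos hφψ Matrix.PosSemidef.one)
    simpa [φa, hone] using this
  obtain ⟨c, hc⟩ : ∃ c : ℝ, ρ (ψ 1) = c :=
    ⟨(ρ (ψ 1)).re, Complex.ext rfl (by simpa using (Complex.le_def.1 hc0).2.symm)⟩
  rw [hc] at hc0 hc1
  have hc0' : 0 ≤ c := by exact_mod_cast hc0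
  have hc1' : c ≤ 1 := by exact_mod_cast hc1
  have hψe : ψ = (c : ℂ) • φ := by
    apply LinearMap.ext
    intro x
    rw [hψL, hψ1, hc, LinearMap.smul_apply, φa, smul_comm]
  have hcne : c ≠ 0 := by
    rintro rfl
    apply hψ0
    rw [hψe]; simp
  have hcp : 0 < c := lt_of_le_of_ne hc0' hcne.symm
  have hs : 0 ≤ 1 / c - 1 := by
    rw [sub_nonneg, le_div_iff₀ hcp]; linarith
  refine ⟨1 / c - 1, hs, ?_⟩
  rw [sub5_qRes_phi ρ hone hs, hψe]
  congr 2
  field_simp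
  ring

/-- For a state `ρ` on `Mₙ(ℂ)` and `φ(A) = ρ(A)·I`, `φ` is q-pure iff `ρ` is faithful. -/
theorem stmt5 {n : ℕ} (ρ : MatC n →ₗ[ℂ] ℂ)
    (hpos : ∀ A : MatC n, A.PosSemidef → 0 ≤ ρ A) (hone : ρ 1 = 1) :
    IsQPure (ρ.smulRight (1 : MatC n)) ↔
      (∀ A : MatC n, A.PosSemidef → A ≠ 0 → 0 < ρ A) := by
  constructor
  · exact sub5_forward ρ hpos hone
  · intro hf
    refine ⟨?_, fun ψ => ⟨?_, sub5_sub ρ hpos hone ψ⟩⟩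
    · simpa using sub5_qpos_rank ρ hpos Matrix.PosSemidef.one hone (c := 1) zero_le_one
    · rintro ⟨h1, h2⟩
      by_cases h0 : ψ = 0
      · exact Or.inl h0
      · exact Or.inr (sub5_backward ρ hpos hone hf ψ h1 h2 h0)
end

section
/- If Ψ: Mₙ(ℂ) → Mₙ(ℂ) is a unital conditionally negative map, then Ψ is invertible, Ψ⁻¹ = ∫₀^∞ e^{−sΨ} ds, and Ψ⁻¹ is q-positive; moreover Ψ⁻¹(I + tΨ⁻¹)⁻¹ = (tI + Ψ)⁻¹ = ∫₀^∞ e^{−st} e^{−sΨ} ds for all t > 0. -/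
open scoped ComplexOrder BigOperators
open Matrix

/-- `ψ` is self-adjoint as a map: `ψ(A*) = ψ(A)*`. -/
def SelfAdjMap {n : ℕ} (ψ : Module.End ℂ (MatC n)) : Prop := ∀ A : MatC n, ψ Aᴴ = (ψ A)ᴴ

/-- Conditionally negative map on `Mₙ(ℂ)`. -/
def IsCondNeg {n : ℕ} (ψ : Module.End ℂ (MatC n)) : Prop :=
  SelfAdjMap ψ ∧
  ∀ (m : ℕ) (A : Fin m → MatC n) (f : Fin m → (Fin n → ℂ)),
    (∑ i, (A i) *ᵥ f i) = 0 →
    ∑ i, ∑ j, star (f i) ⬝ᵥ ((ψ ((A i)ᴴ * A j)) *ᵥ f j) ≤ 0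

/-- `(e^{−sΨ}) A`, defined entrywise via the exponential power series. -/
noncomputable def expApply {n : ℕ} (Ψ : Module.End ℂ (MatC n)) (s : ℝ) (A : MatC n) :
    MatC n :=
  ∑' k : ℕ, ((-s : ℂ) ^ k / (k.factorial : ℂ)) • ((Ψ ^ k) A)


namespace QP

section abstract_exp

variable {V : Type*} [NormedAddCommGroup V] [NormedSpace ℂ V] [FiniteDimensional ℂ V]

/-- `e^{-sT}` on a finite dimensional normed space -/
noncomputable def EV (T : Module.End ℂ V) (s : ℝ) : Module.End ℂ V :=
  (NormedSpace.exp ((s : ℂ) • LinearMap.toContinuousLinearMap (-T)) : V →L[ℂ] V).toLinearMap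

lemma EV_eq (T : Module.End ℂ V) (s : ℝ) (A : V) :
    ∑' k : ℕ, ((-s : ℂ) ^ k / (k.factorial : ℂ)) • ((T ^ k) A) = EV T s A := by
  have := FiniteDimensional.complete ℂ V
  have hs := NormedSpace.exp_series_hasSum_exp' (𝕂 := ℂ)
    ((s : ℂ) • LinearMap.toContinuousLinearMap (-T))
  have h2 := (ContinuousLinearMap.apply ℂ V A).hasSum hs
  have h3 := h2.tsum_eq
  refine Eq.trans (tsum_congr fun k => ?_) h3
  have : ((s : ℂ) • LinearMap.toContinuousLinearMap (-T))
      = (-s : ℂ) • LinearMap.toContinuousLinearMap T := by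
    rw [map_neg]; module
  rw [this, smul_pow, smul_smul]
  simp only [ContinuousLinearMap.apply_apply, _root_.smul_apply]
  rw [div_eq_inv_mul]
  congr 1
  have h4 : ((LinearMap.toContinuousLinearMap T ^ k : V →L[ℂ] V) : V →ₗ[ℂ] V) = T ^ k := by
    simp
  exact congrArg (fun (P : V →ₗ[ℂ] V) => P A) h4.symm

lemma exp_shift {𝔸 : Type*} [NormedRing 𝔸] [NormedAlgebra ℂ 𝔸] [CompleteSpace 𝔸] (c : ℝ) (x : 𝔸) :
    NormedSpace.exp (algebraMap ℂ 𝔸 (c : ℂ) + x) = ((Real.exp c : ℝ) : ℂ) • NormedSpace.exp x := by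
  letI : NormedAlgebra ℚ 𝔸 := NormedAlgebra.restrictScalars ℚ ℂ 𝔸
  rw [NormedSpace.exp_add_of_commute (Algebra.commutes _ _),
      ← NormedSpace.algebraMap_exp_comm, ← Complex.exp_eq_exp_ℂ, ← Complex.ofReal_exp,
      ← Algebra.smul_def]

lemma EV_shift (T : Module.End ℂ V) (t s : ℝ) :
    EV ((t : ℂ) • 1 + T) s = ((Real.exp (-s * t) : ℝ) : ℂ) • EV T s := by
  have := FiniteDimensional.complete ℂ V
  have : (s : ℂ) • LinearMap.toContinuousLinearMap (-((t : ℂ) • (1 : Module.End ℂ V) + T))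
      = algebraMap ℂ (V →L[ℂ] V) ((-s * t : ℝ) : ℂ)
        + (s : ℂ) • LinearMap.toContinuousLinearMap (-T) := by
    ext1 X
    simp [Algebra.algebraMap_eq_smul_one]
    module
  rw [EV, this, exp_shift]
  rfl

lemma EV_deriv (T : Module.End ℂ V) (ℓ : V →ₗ[ℂ] ℂ) (A : V) (s : ℝ) :
    HasDerivAt (fun s : ℝ => ℓ (EV T s A)) (-(ℓ (EV T s (T A)))) s := by
  have := FiniteDimensional.complete ℂ V
  have h := hasDerivAt_exp_smul_const (𝕂 := ℂ) (LinearMap.toContinuousLinearMap (-T)) (s : ℂ)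
  have h2 := (((LinearMap.toContinuousLinearMap ℓ).comp
    (ContinuousLinearMap.apply ℂ V A)).hasFDerivAt.comp_hasDerivAt (s : ℂ) h).comp_ofReal
  convert h2 using 1
  · rfl
  change -ℓ (EV T s (T A)) = ℓ (EV T s ((-T) A))
  rw [LinearMap.neg_apply, map_neg, map_neg]

lemma EV_zero (T : Module.End ℂ V) : EV T 0 = 1 := by
  simp [EV]

/-- closed subset of `End V` -/
def Cl {ι : Type*} (ℓ : ι → Module.End ℂ V →ₗ[ℂ] ℂ) (P : Module.End ℂ V) : Prop := ∀ i, 0 ≤ ℓ i P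

lemma Cl_closed {ι : Type*} (ℓ : ι → Module.End ℂ V →ₗ[ℂ] ℂ) :
    IsClosed {P : V →L[ℂ] V | Cl ℓ P.toLinearMap} := by
  simp only [Cl, Set.ofPred_forall]
  refine isClosed_iInter fun i => ?_
  have hc : Continuous (fun P : V →L[ℂ] V => ℓ i P.toLinearMap) :=
    ((ℓ i).comp (ContinuousLinearMap.coeLM ℂ)).continuous_of_finiteDimensional
  exact isClosed_le continuous_const hc

lemma Cl_exp {ι : Type*} (ℓ : ι → Module.End ℂ V →ₗ[ℂ] ℂ) (P : V →L[ℂ] V)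
    (h : ∀ k : ℕ, Cl ℓ (P.toLinearMap ^ k : Module.End ℂ V)) :
    Cl ℓ (NormedSpace.exp P : V →L[ℂ] V).toLinearMap := by
  have := FiniteDimensional.complete ℂ V
  have hs := NormedSpace.exp_series_hasSum_exp' (𝕂 := ℂ) P
  refine (Cl_closed ℓ).mem_of_tendsto hs (Filter.Eventually.of_forall fun s i => ?_)
  have : (∑ k ∈ s, ((k.factorial : ℂ)⁻¹) • P ^ k : V →L[ℂ] V).toLinearMap
      = ∑ k ∈ s, ((k.factorial : ℂ)⁻¹) • (P.toLinearMap ^ k : Module.End ℂ V) := by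
    ext1 X
    simp
  rw [this, map_sum]
  refine Finset.sum_nonneg fun k _ => ?_
  rw [map_smul, smul_eq_mul]
  refine mul_nonneg ?_ (h k i)
  have h5 : (0:ℂ) ≤ (((k.factorial : ℝ)⁻¹ : ℝ) : ℂ) := Complex.zero_le_real.2 (by positivity)
  simpa using h5

lemma Cl_EV {ι : Type*} (ℓ : ι → Module.End ℂ V →ₗ[ℂ] ℂ) (T R : Module.End ℂ V)
    (h : ∀ r : ℝ, 0 < r → ∀ k : ℕ, Cl ℓ ((1 + (r : ℂ) • (-T + (r : ℂ) • R)) ^ k))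
    (s : ℝ) (hs : 0 ≤ s) : Cl ℓ (EV T s) := by
  have := FiniteDimensional.complete ℂ V
  letI : NormedAlgebra ℚ (V →L[ℂ] V) := NormedAlgebra.restrictScalars ℚ ℂ _
  let Lc := LinearMap.toContinuousLinearMap (-T)
  let Rc := LinearMap.toContinuousLinearMap R
  have hE : ∀ r : ℝ, 0 < r → Cl ℓ (NormedSpace.exp ((s : ℂ) • (Lc + (r : ℂ) • Rc)) :
      V →L[ℂ] V).toLinearMap := by
    intro r hr
    have h2 := Cl_exp ℓ (((s / r : ℝ) : ℂ) • (1 + (r : ℂ) • (Lc + (r : ℂ) • Rc))) (by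
      intro k
      have h0 : (((s / r : ℝ) : ℂ) • (1 + (r : ℂ) • (Lc + (r : ℂ) • Rc)) :
        V →L[ℂ] V).toLinearMap = ((s / r : ℝ) : ℂ) • (1 + (r : ℂ) • (-T + (r : ℂ) • R)) := by
        ext1 X
        simp [Lc, Rc]
      intro i
      rw [h0, smul_pow, map_smul, smul_eq_mul]
      refine mul_nonneg ?_ (h r hr k i)
      have : 0 ≤ (s / r) ^ k := by positivity
      exact_mod_cast this)
    have h3 : (s : ℂ) • (Lc + (r : ℂ) • Rc) = algebraMap ℂ (V →L[ℂ] V) ((-(s / r) : ℝ) : ℂ)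
        + ((s / r : ℝ) : ℂ) • (1 + (r : ℂ) • (Lc + (r : ℂ) • Rc)) := by
      have : (r : ℂ) ≠ 0 := by exact_mod_cast hr.ne'
      rw [Algebra.algebraMap_eq_smul_one, smul_add _ 1, smul_smul]
      have h4 : ((s / r : ℝ) : ℂ) * r = s := by push_cast; field_simp
      rw [h4]
      push_cast
      module
    rw [h3, exp_shift]
    intro i
    rw [ContinuousLinearMap.toLinearMap_smul, map_smul, smul_eq_mul]
    refine mul_nonneg ?_ (h2 i)
    exact_mod_cast (Real.exp_pos _).le
  have hlim : Filter.Tendsto (fun r : ℝ => (NormedSpace.exp ((s : ℂ) • (Lc + (r : ℂ) • Rc)) :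
      V →L[ℂ] V)) (nhdsWithin 0 (Set.Ioi 0)) (nhds (NormedSpace.exp ((s : ℂ) • Lc))) := by
    have : Continuous (fun r : ℝ => (NormedSpace.exp ((s : ℂ) • (Lc + (r : ℂ) • Rc)) :
      V →L[ℂ] V)) := by
      have h0 : Continuous (fun r : ℝ => ((s : ℂ) • (Lc + (r : ℂ) • Rc))) := by fun_prop
      exact NormedSpace.exp_continuous.comp h0
    have h1 := this.tendsto 0
    simp only [Complex.ofReal_zero, zero_smul, add_zero] at h1
    exact h1.mono_left nhdsWithin_le_nhds
  exact (Cl_closed ℓ).mem_of_tendsto hlim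
    (Filter.eventually_of_mem self_mem_nhdsWithin fun r hr => hE r hr)

end abstract_exp

end QP


section QPmain
open scoped Matrix.Norms.L2Operator MatrixOrder

namespace QP

variable {n : ℕ}

/-- the quadratic form of complete positivity -/
noncomputable def qf (φ : Module.End ℂ (MatC n)) (m : ℕ) (A : Fin m → MatC n)
    (f : Fin m → (Fin n → ℂ)) : ℂ :=
  ∑ i, ∑ j, star (f i) ⬝ᵥ ((φ ((A i)ᴴ * A j)) *ᵥ f j)

lemma isCP_iff (φ : Module.End ℂ (MatC n)) : IsCP φ ↔ ∀ m A f, 0 ≤ qf φ m A f := Iff.rfl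

lemma qf_add (φ ψ : Module.End ℂ (MatC n)) (m A f) :
    qf (φ + ψ) m A f = qf φ m A f + qf ψ m A f := by
  simp [qf, Matrix.add_mulVec, Finset.sum_add_distrib]

lemma qf_smul (c : ℂ) (φ : Module.End ℂ (MatC n)) (m A f) :
    qf (c • φ) m A f = c * qf φ m A f := by
  simp [qf, Matrix.smul_mulVec, Finset.mul_sum]

lemma cp_add {φ ψ : Module.End ℂ (MatC n)} (h1 : IsCP φ) (h2 : IsCP ψ) : IsCP (φ + ψ) := by
  intro m A f
  have := add_nonneg (h1 m A f) (h2 m A f)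
  rw [isCP_iff] at h1 h2
  change 0 ≤ qf _ m A f
  rw [qf_add]
  exact add_nonneg (h1 m A f) (h2 m A f)

lemma cp_smul {φ : Module.End ℂ (MatC n)} {c : ℝ} (hc : 0 ≤ c) (h1 : IsCP φ) :
    IsCP ((c : ℂ) • φ) := by
  intro m A f
  change 0 ≤ qf _ m A f
  rw [qf_smul]
  exact mul_nonneg (by exact_mod_cast hc) (h1 m A f)

lemma cp_zero : IsCP (0 : Module.End ℂ (MatC n)) := by
  intro m A f
  simp

lemma cp_conj (φ : Module.End ℂ (MatC n)) (M : MatC n) (hφ : ∀ X, φ X = M * X * Mᴴ) : IsCP φ := by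
  intro m A f
  have : ∑ i, ∑ j, star (f i) ⬝ᵥ ((φ ((A i)ᴴ * A j)) *ᵥ f j)
      = star (∑ i, (A i) *ᵥ (Mᴴ *ᵥ f i)) ⬝ᵥ (∑ i, (A i) *ᵥ (Mᴴ *ᵥ f i)) := by
    rw [star_sum, sum_dotProduct]
    refine Finset.sum_congr rfl fun i _ => ?_
    rw [dotProduct_sum]
    refine Finset.sum_congr rfl fun j _ => ?_
    rw [hφ]
    simp only [star_mulVec, ← mulVec_mulVec, ← dotProduct_mulVec, conjTranspose_conjTranspose,
      mul_assoc]
  rw [this]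
  exact dotProduct_star_self_nonneg _

lemma cp_one : IsCP (1 : Module.End ℂ (MatC n)) :=
  cp_conj _ 1 (by simp)

/-- block matrix -/
lemma block_psd {φ : Module.End ℂ (MatC n)} (h : IsCP φ) (m : ℕ) (A : Fin m → MatC n) :
    (Matrix.of fun (p q : Fin m × Fin n) => φ ((A p.1)ᴴ * A q.1) p.2 q.2).PosSemidef := by
  set M : Matrix (Fin m × Fin n) (Fin m × Fin n) ℂ :=
    Matrix.of fun (p q : Fin m × Fin n) => φ ((A p.1)ᴴ * A q.1) p.2 q.2 with hM
  have key : ∀ x : Fin m × Fin n → ℂ, 0 ≤ star x ⬝ᵥ (M *ᵥ x) := by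
    intro x
    have := h m A (fun i a => x (i, a))
    convert this using 1
    simp only [dotProduct, mulVec, hM, Fintype.sum_prod_type, Matrix.of_apply, Pi.star_apply,
      Finset.mul_sum]
    refine Finset.sum_congr rfl fun i _ => ?_
    rw [Finset.sum_comm]
  rw [← Matrix.isPositive_toEuclideanLin_iff, LinearMap.isPositive_iff_complex]
  intro x
  have h1 := key x.ofLp
  have h2 : inner ℂ (M.toEuclideanLin x) x = star (star x.ofLp ⬝ᵥ (M *ᵥ x.ofLp)) := by
    rw [EuclideanSpace.inner_eq_star_dotProduct]
    simp [Matrix.toEuclideanLin, dotProduct_comm, star_dotProduct]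
  rw [h2]
  have h3 := Complex.le_def.1 h1
  simp only [Complex.zero_re, Complex.zero_im] at h3
  refine ⟨?_, ?_⟩
  · apply Complex.ext <;> simp [← h3.2]
  · simpa using h3.1

lemma psd_decomp {ι : Type*} [Fintype ι] [DecidableEq ι] {M : Matrix ι ι ℂ} (h : M.PosSemidef) :
    ∃ B : Matrix ι ι ℂ, M = Bᴴ * B := by
  have := CStarAlgebra.nonneg_iff_eq_star_mul_self.1 (Matrix.nonneg_iff_posSemidef.2 h)
  exact this

lemma cp_mul {φ ψ : Module.End ℂ (MatC n)} (h1 : IsCP φ) (h2 : IsCP ψ) : IsCP (φ * ψ) := by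
  intro m A f
  obtain ⟨B, hB⟩ := psd_decomp (block_psd h2 m A)
  let C : Fin m → Fin m → MatC n := fun k i => Matrix.of fun a b => B (k, a) (i, b)
  have hC : ∀ i j, ψ ((A i)ᴴ * A j) = ∑ k, (C k i)ᴴ * C k j := by
    intro i j
    ext a b
    have := congrFun (congrFun hB (i, a)) (j, b)
    simp only [Matrix.of_apply] at this
    rw [this]
    simp [Matrix.mul_apply, Fintype.sum_prod_type, Matrix.sum_apply, C]
  have : ∑ i, ∑ j, star (f i) ⬝ᵥ (((φ * ψ) ((A i)ᴴ * A j)) *ᵥ f j)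
      = ∑ k, ∑ i, ∑ j, star (f i) ⬝ᵥ ((φ ((C k i)ᴴ * C k j)) *ᵥ f j) := by
    simp only [Module.End.mul_apply, hC, map_sum, Matrix.sum_mulVec, dotProduct_sum]
    rw [Finset.sum_comm (f := fun k i => ∑ j, star (f i) ⬝ᵥ ((φ ((C k i)ᴴ * C k j)) *ᵥ f j))]
    refine Finset.sum_congr rfl fun i _ => ?_
    rw [Finset.sum_comm]
  rw [this]
  exact Finset.sum_nonneg fun k _ => h1 m (C k) f

lemma cp_pow {φ : Module.End ℂ (MatC n)} (h1 : IsCP φ) (k : ℕ) : IsCP (φ ^ k) := by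
  induction k with
  | zero => simpa using cp_one
  | succ k ih => rw [pow_succ]; exact cp_mul ih h1

lemma exists_bound (A : MatC n) : ∃ B : MatC n, ((‖A‖ ^ 2 : ℝ) : ℂ) • (1 : MatC n) = Aᴴ * A + Bᴴ * B := by
  have h := CStarAlgebra.star_mul_le_algebraMap_norm_sq (a := A)
  rw [← sub_nonneg] at h
  obtain ⟨B, hB⟩ := CStarAlgebra.nonneg_iff_eq_star_mul_self.1 h
  refine ⟨B, ?_⟩
  rw [← star_eq_conjTranspose B, ← hB, ← star_eq_conjTranspose A, add_sub_cancel,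
    Algebra.algebraMap_eq_smul_one]
  rw [Complex.coe_smul]

lemma cp_entry {φ : Module.End ℂ (MatC n)} (h : IsCP φ) {c : ℝ} (hc : 0 < c)
    (h1 : φ 1 = (c : ℂ) • 1) (A : MatC n) (i j : Fin n) : ‖φ A i j‖ ≤ c * ‖A‖ := by
  obtain ⟨B, hB⟩ := exists_bound A
  have hH : φ Aᴴ j i = star (φ A i j) := by
    have := (block_psd h 2 ![1, A]).1.apply (1, j) (0, i)
    simpa using this.symm
  set y := φ A i j with hy
  have e1 := h 2 ![1, A] ![Pi.single i (-(y / c)), Pi.single j 1]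
  have e2 := h 1 ![B] ![Pi.single j 1]
  have e3 := congrArg (fun X => φ X j j) hB
  simp [Fin.sum_univ_two, h1, hH, ← hy, Pi.star_single] at e1 e2 e3
  have hc' : (c : ℂ) ≠ 0 := by exact_mod_cast hc.ne'
  have e4 := add_nonneg e1 e2
  have e5 : (starRingEnd ℂ) y / ↑c * ↑c * (y * (↑c)⁻¹) + -((starRingEnd ℂ) y / ↑c * y) +
      (-((starRingEnd ℂ) y * (y * (↑c)⁻¹)) + φ (Aᴴ * A) j j) + φ (Bᴴ * B) j j
      = ((‖A‖ ^ 2 * c - ‖y‖ ^ 2 / c : ℝ) : ℂ) := by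
    have e6 := Complex.conj_mul' y
    push_cast
    rw [e3, ← e6]
    field_simp
    ring
  rw [e5] at e4
  have e7 : 0 ≤ ‖A‖ ^ 2 * c - ‖y‖ ^ 2 / c := by exact_mod_cast e4
  have e8 : ‖y‖ ^ 2 ≤ (c * ‖A‖) ^ 2 := by
    have : ‖y‖ ^ 2 / c ≤ ‖A‖ ^ 2 * c := by linarith
    rw [div_le_iff₀ hc] at this
    nlinarith
  exact (sq_le_sq₀ (by positivity) (by positivity)).1 e8

/-- the quadratic form as a linear functional -/
noncomputable def qfL (x : (m : ℕ) × ((Fin m → MatC n) × (Fin m → (Fin n → ℂ)))) :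
    Module.End ℂ (MatC n) →ₗ[ℂ] ℂ where
  toFun φ := qf φ x.1 x.2.1 x.2.2
  map_add' φ ψ := qf_add φ ψ _ _ _
  map_smul' c φ := qf_smul c φ _ _ _

/-- `e^{-sT}` -/
noncomputable def E (T : Module.End ℂ (MatC n)) (s : ℝ) : Module.End ℂ (MatC n) :=
  EV (V := MatC n) T s

lemma E_cp_of (T R : Module.End ℂ (MatC n))
    (h : ∀ r : ℝ, 0 < r → IsCP (1 + (r : ℂ) • (-T + (r : ℂ) • R)))
    (s : ℝ) (hs : 0 ≤ s) : IsCP (E T s) := by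
  have h1 := Cl_EV (V := MatC n) qfL T R (fun r hr k x => cp_pow (h r hr) k x.1 x.2.1 x.2.2) s hs
  exact fun m A f => h1 ⟨m, A, f⟩

end QP

namespace QP

variable {n : ℕ}

section EL
variable (L : Module.End ℂ (MatC n)) (z : Fin n)

/-- the matrix `K₀` -/
noncomputable def K0 : MatC n := Matrix.of fun a b => L (Matrix.single b z 1) a z

/-- rank one matrix -/
noncomputable def W (v : Fin n → ℂ) : MatC n := vecMulVec v (Pi.single z 1)

lemma W_eq (v : Fin n → ℂ) : W z v = ∑ b, v b • Matrix.single b z (1 : ℂ) := by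
  ext i j
  simp [W, vecMulVec_apply, Matrix.sum_apply, Matrix.single_apply, Pi.single_apply, ite_and]
  simp [eq_comm]

lemma L_W (v : Fin n → ℂ) : L (W z v) *ᵥ Pi.single z 1 = K0 L z *ᵥ v := by
  rw [W_eq, map_sum]
  ext a
  rw [mulVec_single_one, Matrix.col_apply]
  simp only [map_smul, Matrix.sum_apply, K0, mulVec, dotProduct,
    Matrix.smul_apply, Matrix.of_apply, smul_eq_mul]
  exact Finset.sum_congr rfl fun _ _ => mul_comm _ _

lemma mul_W (A : MatC n) (v : Fin n → ℂ) : A * W z v = W z (A *ᵥ v) := by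
  simp [W, mul_vecMulVec]

lemma W_mul_W (v : Fin n → ℂ) : (W z v)ᴴ * W z v = (star v ⬝ᵥ v) • W z (Pi.single z 1) := by
  ext i j
  simp [W, Matrix.mul_apply, vecMulVec_apply, dotProduct, Pi.single_apply]

lemma dot_W (hL : SelfAdjMap L) (A : MatC n) (v f : Fin n → ℂ) :
    star (Pi.single z 1 : Fin n → ℂ) ⬝ᵥ (L ((W z v)ᴴ * A) *ᵥ f)
      = star (K0 L z *ᵥ (Aᴴ *ᵥ v)) ⬝ᵥ f := by
  have : (W z v)ᴴ * A = (W z (Aᴴ *ᵥ v))ᴴ := by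
    rw [← mul_W]; simp
  rw [this, hL, ← L_W, star_mulVec, ← dotProduct_mulVec]

lemma dot_W' (A : MatC n) (v f : Fin n → ℂ) :
    star f ⬝ᵥ (L (Aᴴ * W z v) *ᵥ (Pi.single z 1)) = star f ⬝ᵥ (K0 L z *ᵥ (Aᴴ *ᵥ v)) := by
  rw [mul_W, L_W]

/-- the completely positive part -/
noncomputable def Phi : Module.End ℂ (MatC n) :=
  L - LinearMap.mulLeft ℂ (K0 L z) - LinearMap.mulRight ℂ (K0 L z)ᴴ
    + (L (Matrix.single z z 1) z z) • 1

lemma Phi_apply (X : MatC n) : Phi L z X = L X - K0 L z * X - X * (K0 L z)ᴴ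
    + (L (Matrix.single z z 1) z z) • X := by simp [Phi]

lemma Phi_cp (hL : SelfAdjMap L)
    (h : ∀ (m : ℕ) (A : Fin m → MatC n) (f : Fin m → (Fin n → ℂ)),
      (∑ i, (A i) *ᵥ f i) = 0 →
      0 ≤ ∑ i, ∑ j, star (f i) ⬝ᵥ ((L ((A i)ᴴ * A j)) *ᵥ f j)) : IsCP (Phi L z) := by
  intro m A f
  set g := ∑ i, (A i) *ᵥ f i with hg
  have h1 := h (m + 1) (Fin.cons (-W z g) A) (Fin.cons (Pi.single z 1) f) (by
    rw [Fin.sum_univ_succ]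
    simp only [Fin.cons_zero, Fin.cons_succ, ← hg]
    rw [neg_mulVec, neg_add_eq_zero]
    ext a
    simp [W, vecMulVec_apply])
  rw [Fin.sum_univ_succ] at h1
  simp only [Fin.sum_univ_succ, Fin.cons_zero, Fin.cons_succ, conjTranspose_neg, neg_mul, mul_neg,
    map_neg, neg_mulVec, dotProduct_neg, W_mul_W, map_smul,
    smul_mulVec, dotProduct_smul, Finset.sum_neg_distrib, Finset.sum_add_distrib] at h1
  simp only [dot_W L z hL, dot_W'] at h1
  have e1 : ∑ i, ∑ j, star (f i) ⬝ᵥ ((K0 L z * ((A i)ᴴ * A j)) *ᵥ f j)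
      = ∑ i, star (f i) ⬝ᵥ (K0 L z *ᵥ ((A i)ᴴ *ᵥ g)) := by
    refine Finset.sum_congr rfl fun i _ => ?_
    rw [hg, mulVec_sum, mulVec_sum, dotProduct_sum]
    simp only [mulVec_mulVec]
  have e2 : ∑ i, ∑ j, star (f i) ⬝ᵥ ((((A i)ᴴ * A j) * (K0 L z)ᴴ) *ᵥ f j)
      = ∑ j, star (K0 L z *ᵥ ((A j)ᴴ *ᵥ g)) ⬝ᵥ f j := by
    rw [Finset.sum_comm]
    refine Finset.sum_congr rfl fun j _ => ?_
    rw [hg, mulVec_sum, mulVec_sum, star_sum, sum_dotProduct]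
    refine Finset.sum_congr rfl fun i _ => ?_
    simp only [star_mulVec, conjTranspose_conjTranspose, ← dotProduct_mulVec, mulVec_mulVec, mul_assoc,
      conjTranspose_mul]
  have e3 : ∑ i, ∑ j, star (f i) ⬝ᵥ (((A i)ᴴ * A j) *ᵥ f j) = star g ⬝ᵥ g := by
    rw [hg, star_sum, sum_dotProduct]
    refine Finset.sum_congr rfl fun i _ => ?_
    rw [dotProduct_sum]
    refine Finset.sum_congr rfl fun j _ => ?_
    simp only [star_mulVec, ← dotProduct_mulVec, mulVec_mulVec]
  have e4 : star (Pi.single z 1 : Fin n → ℂ) ⬝ᵥ (L (W z (Pi.single z 1)) *ᵥ (Pi.single z 1))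
      = L (Matrix.single z z 1) z z := by
    have : W z (Pi.single z 1) = Matrix.single z z 1 := by
      ext i j; simp [W, vecMulVec_apply, Matrix.single_apply, Pi.single_apply, ite_and]
      by_cases h : i = z <;> by_cases h' : j = z <;> simp [h, h', Ne.symm]
    rw [this, ← Pi.single_star]; simp
  rw [e4] at h1
  convert h1 using 1
  simp only [Phi_apply, sub_mulVec, add_mulVec, dotProduct_add, dotProduct_sub, smul_mulVec,
    dotProduct_smul, Finset.sum_add_distrib, Finset.sum_sub_distrib, e1, e2, smul_eq_mul]
  simp only [← Finset.mul_sum, e3]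
  ring

set_option maxHeartbeats 1000000 in
/-- Evans-Lewis -/
lemma evans_lewis (hL : SelfAdjMap L)
    (h : ∀ (m : ℕ) (A : Fin m → MatC n) (f : Fin m → (Fin n → ℂ)),
      (∑ i, (A i) *ᵥ f i) = 0 →
      0 ≤ ∑ i, ∑ j, star (f i) ⬝ᵥ ((L ((A i)ᴴ * A j)) *ᵥ f j)) (s : ℝ) (hs : 0 ≤ s) :
    IsCP (E (-L) s) := by
  rcases isEmpty_or_nonempty (Fin n) with hn | ⟨⟨z⟩⟩
  · intro m A f
    simp [dotProduct]
  set c := L (Matrix.single z z 1) z z with hc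
  have hcr : star c = c := by
    have := congrFun (congrFun (hL (Matrix.single z z 1)) z) z
    simpa using this.symm
  set K : MatC n := K0 L z - (c / 2) • 1 with hK
  let R : Module.End ℂ (MatC n) := LinearMap.mulLeft ℂ K * LinearMap.mulRight ℂ Kᴴ
  have hS : ∀ r : ℝ, 0 ≤ r → IsCP (1 + (r : ℂ) • (L + (r : ℂ) • R)) := by
    intro r hr
    have h1 : IsCP (LinearMap.mulLeft ℂ (1 + (r : ℂ) • K) * LinearMap.mulRight ℂ (1 + (r : ℂ) • K)ᴴ) :=
      cp_conj _ (1 + (r : ℂ) • K) (by intro X; simp [mul_assoc])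
    have h2 := cp_add h1 (cp_smul hr (Phi_cp L z hL h))
    convert h2 using 1
    ext1 X
    have hKs : Kᴴ = (K0 L z)ᴴ - (c / 2) • 1 := by
      rw [hK, conjTranspose_sub, conjTranspose_smul, star_div₀, hcr]; simp
    have hK0 : K0 L z = K + (c / 2) • 1 := by simp [hK]
    have hK0s : (K0 L z)ᴴ = Kᴴ + (c / 2) • 1 := by simp [hKs]
    simp only [LinearMap.add_apply, LinearMap.smul_apply, Module.End.mul_apply, Module.End.one_apply,
      Phi_apply, R, LinearMap.mulLeft_apply, LinearMap.mulRight_apply, conjTranspose_add,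
      conjTranspose_smul, conjTranspose_one, ← hc, hK0s]
    rw [hK0]
    simp only [add_mul, mul_add, smul_mul_assoc, mul_smul_comm, one_mul, mul_one, smul_add, smul_sub,
      Complex.star_def, Complex.conj_ofReal]
    module
  refine E_cp_of (-L) R (fun r hr => ?_) s hs
  rw [neg_neg]
  exact hS r hr.le

end EL
end QP

namespace QP

variable {n : ℕ}

lemma expApply_eq (T : Module.End ℂ (MatC n)) (s : ℝ) (A : MatC n) :
    expApply T s A = E T s A := EV_eq (V := MatC n) T s A

lemma E_shift (T : Module.End ℂ (MatC n)) (t s : ℝ) :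
    E ((t : ℂ) • 1 + T) s = ((Real.exp (-s * t) : ℝ) : ℂ) • E T s :=
  EV_shift (V := MatC n) T t s

lemma E_deriv (T : Module.End ℂ (MatC n)) (A : MatC n) (i j : Fin n) (s : ℝ) :
    HasDerivAt (fun s : ℝ => E T s A i j) (-(E T s (T A) i j)) s :=
  EV_deriv (V := MatC n) T (Matrix.entryLinearMap ℂ ℂ i j) A s

lemma E_zero (T : Module.End ℂ (MatC n)) : E T 0 = 1 := EV_zero (V := MatC n) T

lemma E_cont (T : Module.End ℂ (MatC n)) (A : MatC n) (i j : Fin n) :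
    Continuous (fun s : ℝ => E T s A i j) :=
  continuous_iff_continuousAt.2 fun s => (E_deriv T A i j s).continuousAt

lemma E_one (T : Module.End ℂ (MatC n)) (h : T 1 = 1) (s : ℝ) :
    E T s 1 = ((Real.exp (-s) : ℝ) : ℂ) • 1 := by
  rw [← expApply_eq, expApply]
  have hk : ∀ k : ℕ, (T ^ k) 1 = 1 := by
    intro k
    induction k with
    | zero => simp
    | succ k ih => rw [pow_succ, Module.End.mul_apply, h, ih]
  simp only [hk]
  have h1 := (NormedSpace.exp_series_hasSum_exp' (𝕂 := ℂ) (-s : ℂ)).smul_const (1 : MatC n)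
  rw [← Complex.exp_eq_exp_ℂ] at h1
  rw [Complex.ofReal_exp, Complex.ofReal_neg, ← h1.tsum_eq]
  refine tsum_congr fun k => ?_
  rw [div_eq_inv_mul, smul_eq_mul]

lemma E_cp (Ψ : Module.End ℂ (MatC n)) (hcn : IsCondNeg Ψ) (s : ℝ) (hs : 0 ≤ s) :
    IsCP (E Ψ s) := by
  have key := evans_lewis (-Ψ) ?_ ?_ s hs
  · rwa [neg_neg] at key
  · intro A
    simp [hcn.1 A]
  · intro m A f h
    have := hcn.2 m A f h
    simpa [neg_mulVec] using this

section main
variable (Ψ : Module.End ℂ (MatC n))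

lemma E_bound (hone : Ψ 1 = 1) (hcn : IsCondNeg Ψ) (A : MatC n) (i j : Fin n) (s : ℝ) (hs : 0 ≤ s) :
    ‖E Ψ s A i j‖ ≤ Real.exp (-s) * ‖A‖ :=
  cp_entry (E_cp Ψ hcn s hs) (Real.exp_pos _) (E_one Ψ hone s) A i j

lemma E_bound' (hone : Ψ 1 = 1) (hcn : IsCondNeg Ψ) (t : ℝ) (ht : 0 ≤ t) (A : MatC n) (i j : Fin n) (s : ℝ) (hs : 0 ≤ s) :
    ‖E ((t : ℂ) • 1 + Ψ) s A i j‖ ≤ Real.exp (-s) * ‖A‖ := by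
  have h1 := E_bound Ψ hone hcn A i j s hs
  rw [E_shift]
  simp only [LinearMap.smul_apply, Matrix.smul_apply, norm_smul, Complex.norm_real,
    Real.norm_eq_abs, Real.abs_exp]
  have h2 : Real.exp (-s * t) ≤ 1 := Real.exp_le_one_iff.2 (by nlinarith)
  calc _ ≤ 1 * ‖E Ψ s A i j‖ := by gcongr
    _ ≤ _ := by rwa [one_mul]

open MeasureTheory in
lemma E_int (hone : Ψ 1 = 1) (hcn : IsCondNeg Ψ) (t : ℝ) (ht : 0 ≤ t) (A : MatC n) (i j : Fin n) :
    IntegrableOn (fun s : ℝ => E ((t : ℂ) • 1 + Ψ) s A i j) (Set.Ioi 0) := by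
  have h1 : IntegrableOn (fun s : ℝ => Real.exp (-s) * ‖A‖) (Set.Ioi 0) :=
    (integrableOn_exp_neg_Ioi 0).mul_const _
  refine h1.mono' (E_cont _ A i j).aestronglyMeasurable ?_
  refine (ae_restrict_mem measurableSet_Ioi).mono fun s hs => ?_
  exact E_bound' Ψ hone hcn t ht A i j s (le_of_lt hs)

open MeasureTheory in
lemma E_ftc (hone : Ψ 1 = 1) (hcn : IsCondNeg Ψ) (t : ℝ) (ht : 0 ≤ t) (A : MatC n) (i j : Fin n) :
    ∫ s in Set.Ioi (0 : ℝ), E ((t : ℂ) • 1 + Ψ) s (((t : ℂ) • 1 + Ψ) A) i j = A i j := by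
  set T := (t : ℂ) • 1 + Ψ with hT
  have hlim : Filter.Tendsto (fun s : ℝ => E T s A i j) Filter.atTop (nhds 0) := by
    have h0 : Filter.Tendsto (fun s : ℝ => Real.exp (-s) * ‖A‖) Filter.atTop (nhds 0) := by
      simpa using (Real.tendsto_exp_neg_atTop_nhds_zero).mul_const ‖A‖
    refine squeeze_zero_norm' ?_ h0
    filter_upwards [Filter.eventually_ge_atTop 0] with s hs
    exact E_bound' Ψ hone hcn t ht A i j s hs
  have := integral_Ioi_of_hasDerivAt_of_tendsto (a := (0 : ℝ))
    (E_cont T A i j).continuousWithinAt (fun s _ => E_deriv T A i j s)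
    (E_int Ψ hone hcn t ht (T A) i j).neg hlim
  rw [integral_neg] at this
  have h0 : E T 0 A i j = A i j := by simp [E_zero]
  rw [h0, zero_sub, neg_inj] at this
  exact this

lemma T_unit (hone : Ψ 1 = 1) (hcn : IsCondNeg Ψ) (t : ℝ) (ht : 0 ≤ t) : IsUnit ((t : ℂ) • 1 + Ψ) := by
  rw [LinearMap.isUnit_iff_ker_eq_bot, LinearMap.ker_eq_bot']
  intro A hA
  ext i j
  have := E_ftc Ψ hone hcn t ht A i j
  rw [hA] at this
  simpa using this.symm

lemma T_inv (hone : Ψ 1 = 1) (hcn : IsCondNeg Ψ) (t : ℝ) (ht : 0 ≤ t) (A : MatC n) (i j : Fin n) :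
    Ring.inverse ((t : ℂ) • 1 + Ψ) A i j
      = ∫ s in Set.Ioi (0 : ℝ), E ((t : ℂ) • 1 + Ψ) s A i j := by
  have h := E_ftc Ψ hone hcn t ht (Ring.inverse ((t : ℂ) • 1 + Ψ) A) i j
  rw [← Module.End.mul_apply, Ring.mul_inverse_cancel _ (T_unit Ψ hone hcn t ht),
    Module.End.one_apply] at h
  exact h.symm

open MeasureTheory in
lemma T_inv_cp (hone : Ψ 1 = 1) (hcn : IsCondNeg Ψ) (t : ℝ) (ht : 0 ≤ t) : IsCP (Ring.inverse ((t : ℂ) • 1 + Ψ)) := by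
  intro m A f
  have h1 : ∑ i, ∑ j, star (f i) ⬝ᵥ ((Ring.inverse ((t : ℂ) • 1 + Ψ) ((A i)ᴴ * A j)) *ᵥ f j)
      = ∫ s in Set.Ioi (0 : ℝ), ∑ i, ∑ j, star (f i) ⬝ᵥ
        ((E ((t : ℂ) • 1 + Ψ) s ((A i)ᴴ * A j)) *ᵥ f j) := by
    simp only [dotProduct, mulVec, T_inv Ψ hone hcn t ht]
    have hi : ∀ i j a b, IntegrableOn (fun s : ℝ =>
        E ((t : ℂ) • 1 + Ψ) s ((A i)ᴴ * A j) a b * f j b) (Set.Ioi 0) := fun i j a b =>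
      (E_int Ψ hone hcn t ht ((A i)ᴴ * A j) a b).mul_const _
    have hi2 : ∀ i j a, IntegrableOn (fun s : ℝ => star (f i) a * ∑ b,
        E ((t : ℂ) • 1 + Ψ) s ((A i)ᴴ * A j) a b * f j b) (Set.Ioi 0) := fun i j a =>
      (integrable_finsetSum _ fun b _ => hi i j a b).const_mul _
    have hi3 : ∀ i j, IntegrableOn (fun s : ℝ => ∑ a, star (f i) a * ∑ b,
        E ((t : ℂ) • 1 + Ψ) s ((A i)ᴴ * A j) a b * f j b) (Set.Ioi 0) := fun i j =>
      integrable_finsetSum _ fun a _ => hi2 i j a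
    rw [integral_finsetSum _ fun i _ => integrable_finsetSum _ fun j _ => hi3 i j]
    refine Finset.sum_congr rfl fun i _ => ?_
    rw [integral_finsetSum _ fun j _ => hi3 i j]
    refine Finset.sum_congr rfl fun j _ => ?_
    rw [integral_finsetSum _ fun a _ => hi2 i j a]
    refine Finset.sum_congr rfl fun a _ => ?_
    rw [integral_const_mul, integral_finsetSum _ fun b _ => hi i j a b]
    congr 1
    refine Finset.sum_congr rfl fun b _ => ?_
    rw [integral_mul_const]
  rw [h1]
  refine integral_nonneg_of_ae ?_
  refine (ae_restrict_mem measurableSet_Ioi).mono fun s hs => ?_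
  have h2 : IsCP (E ((t : ℂ) • 1 + Ψ) s) := by
    rw [E_shift]
    exact cp_smul (Real.exp_pos _).le (E_cp Ψ hcn s (le_of_lt hs))
  exact h2 m A f

lemma Psi_unit (hone : Ψ 1 = 1) (hcn : IsCondNeg Ψ) : IsUnit Ψ := by
  simpa using T_unit Ψ hone hcn 0 le_rfl

lemma qRes_eq (hone : Ψ 1 = 1) (hcn : IsCondNeg Ψ) (t : ℝ) (ht : 0 ≤ t) :
    qRes (Ring.inverse Ψ) t = Ring.inverse ((t : ℂ) • 1 + Ψ) := by
  have hu := Psi_unit Ψ hone hcn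
  have hT := T_unit Ψ hone hcn t ht
  have h1 : (1 + (t : ℂ) • Ring.inverse Ψ) = ((t : ℂ) • 1 + Ψ) * Ring.inverse Ψ := by
    rw [add_mul, Ring.mul_inverse_cancel _ hu, smul_mul_assoc, one_mul, add_comm]
  have hc : Commute ((t : ℂ) • 1 + Ψ) Ψ := by
    refine Commute.add_left ?_ (Commute.refl _)
    exact (Commute.one_left Ψ).smul_left _
  have hc2 : Commute ((t : ℂ) • 1 + Ψ) (Ring.inverse Ψ) := by
    obtain ⟨u, hu⟩ := hu
    rw [← hu] at hc ⊢
    rw [Ring.inverse_unit]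
    exact hc.units_inv_right
  rw [qRes, h1, Ring.inverse_mul (Or.inl hT), Ring.inverse_inverse, ← mul_assoc,
    Ring.inverse_mul_cancel _ hu, one_mul]
  exact hu

end main
end QP

end QPmain

/-- A unital conditionally negative map `Ψ` is invertible, `Ψ⁻¹ = ∫₀^∞ e^{−sΨ} ds`,
`Ψ⁻¹` is q-positive, and `Ψ⁻¹(I + tΨ⁻¹)⁻¹ = (tI + Ψ)⁻¹ = ∫₀^∞ e^{−st}e^{−sΨ} ds` for
all `t > 0`. -/
theorem stmt9 {n : ℕ} (Ψ : Module.End ℂ (MatC n)) (hone : Ψ 1 = 1)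
    (hcn : IsCondNeg Ψ) :
    IsUnit Ψ ∧
    (∀ (A : MatC n) (i j : Fin n),
      (Ring.inverse Ψ) A i j = ∫ s in Set.Ioi (0 : ℝ), expApply Ψ s A i j) ∧
    IsQPos (Ring.inverse Ψ) ∧
    ∀ t : ℝ, 0 < t →
      qRes (Ring.inverse Ψ) t = Ring.inverse ((t : ℂ) • 1 + Ψ) ∧
      ∀ (A : MatC n) (i j : Fin n),
        Ring.inverse ((t : ℂ) • 1 + Ψ) A i j
          = ∫ s in Set.Ioi (0 : ℝ), Real.exp (-s * t) • expApply Ψ s A i j := by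
  refine ⟨QP.Psi_unit Ψ hone hcn, ?_, ⟨?_, ?_⟩, ?_⟩
  · intro A i j
    have := QP.T_inv Ψ hone hcn 0 le_rfl A i j
    simpa [QP.expApply_eq] using this
  · intro r hr h
    obtain ⟨v, hv⟩ := h.exists_hasEigenvector
    have h1 := hv.apply_eq_smul
    have hu := QP.Psi_unit Ψ hone hcn
    have hr' : (r : ℂ) ≠ 0 := by exact_mod_cast hr.ne
    have h2 : v = (r : ℂ) • Ψ v := by
      rw [← map_smul, ← h1, ← Module.End.mul_apply, Ring.mul_inverse_cancel _ hu,
        Module.End.one_apply]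
    have hT := QP.T_unit Ψ hone hcn (-r⁻¹) (by
      have := inv_lt_zero.2 hr
      linarith)
    rw [LinearMap.isUnit_iff_ker_eq_bot, LinearMap.ker_eq_bot'] at hT
    refine hv.2 (hT v ?_)
    have h3 : Ψ v = (r : ℂ)⁻¹ • v := by
      rw [eq_inv_smul_iff₀ hr']; exact h2.symm
    simp [h3]
  · intro t ht
    rw [QP.qRes_eq Ψ hone hcn t ht]
    exact QP.T_inv_cp Ψ hone hcn t ht
  · intro t ht
    refine ⟨QP.qRes_eq Ψ hone hcn t ht.le, fun A i j => ?_⟩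
    rw [QP.T_inv Ψ hone hcn t ht.le]
    refine MeasureTheory.integral_congr_ae (Filter.Eventually.of_forall fun s => ?_)
    simp only [QP.E_shift, QP.expApply_eq]
    simp
end

section
/- Let φ₁: Mₙ(ℂ) → Mₙ(ℂ) be an invertible unital q-positive map with ψ₁ = φ₁⁻¹. If ψ₂: Mₙ(ℂ) → Mₙ(ℂ) is conditionally negative and ψ₂ − ψ₁ is completely positive, then ψ₂ is invertible and φ₂ := ψ₂⁻¹ satisfies φ₁ ≥_q φ₂ ≥_q 0. -/
open scoped ComplexOrder BigOperators
open Matrix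

/-- The quadratic form in the definition of complete positivity, as a linear functional. -/
noncomputable def cpForm {n : ℕ} (m : ℕ) (A : Fin m → MatC n) (f : Fin m → (Fin n → ℂ)) :
    Module.End ℂ (MatC n) →ₗ[ℂ] ℂ where
  toFun φ := ∑ i, ∑ j, star (f i) ⬝ᵥ ((φ ((A i)ᴴ * A j)) *ᵥ f j)
  map_add' φ ψ := by
    simp [Matrix.add_mulVec, Finset.sum_add_distrib]
  map_smul' c φ := by
    simp [Matrix.smul_mulVec, Finset.mul_sum]

lemma isCP_iff {n : ℕ} (φ : Module.End ℂ (MatC n)) :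
    IsCP φ ↔ ∀ m A f, 0 ≤ cpForm (n := n) m A f φ := Iff.rfl

lemma isCP_zero {n : ℕ} : IsCP (0 : Module.End ℂ (MatC n)) := by
  rw [isCP_iff]; intro m A f; simp

lemma IsCP.add {n : ℕ} {φ ψ : Module.End ℂ (MatC n)} (h1 : IsCP φ) (h2 : IsCP ψ) :
    IsCP (φ + ψ) := by
  rw [isCP_iff] at *; intro m A f; rw [map_add]; exact add_nonneg (h1 m A f) (h2 m A f)

lemma IsCP.smul {n : ℕ} {φ : Module.End ℂ (MatC n)} (h1 : IsCP φ) {c : ℝ} (hc : 0 ≤ c) :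
    IsCP ((c : ℂ) • φ) := by
  rw [isCP_iff] at *; intro m A f; rw [map_smul, smul_eq_mul]
  exact mul_nonneg (by exact_mod_cast hc) (h1 m A f)

lemma isCP_sum {n : ℕ} (s : Finset ℕ) (F : ℕ → Module.End ℂ (MatC n)) (h : ∀ k, IsCP (F k)) :
    IsCP (∑ k ∈ s, F k) := by
  rw [isCP_iff]; intro m A f; rw [map_sum]
  exact Finset.sum_nonneg fun k _ => h k m A f

/-- `A ↦ B A Bᴴ`. -/
noncomputable def adM {n : ℕ} (B : MatC n) : Module.End ℂ (MatC n) :=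
  LinearMap.mulLeft ℂ B * LinearMap.mulRight ℂ Bᴴ

lemma adM_apply {n : ℕ} (B A : MatC n) : adM B A = B * A * Bᴴ := by
  simp [adM, mul_assoc]

lemma isCP_adM {n : ℕ} (B : MatC n) : IsCP (adM B) := by
  intro m A f
  have : ∑ i, ∑ j, star (f i) ⬝ᵥ ((adM B ((A i)ᴴ * A j)) *ᵥ f j)
      = star (∑ i, (A i * Bᴴ) *ᵥ f i) ⬝ᵥ (∑ i, (A i * Bᴴ) *ᵥ f i) := by
    rw [star_sum, sum_dotProduct]
    refine Finset.sum_congr rfl fun i _ => ?_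
    rw [dotProduct_sum]
    refine Finset.sum_congr rfl fun j _ => ?_
    rw [star_mulVec, ← dotProduct_mulVec, mulVec_mulVec, adM_apply]
    simp [mul_assoc]
  rw [this]
  exact dotProduct_star_self_nonneg _

lemma isCP_one {n : ℕ} : IsCP (1 : Module.End ℂ (MatC n)) := by
  have : (1 : Module.End ℂ (MatC n)) = adM 1 := by ext1 A; simp [adM_apply]
  rw [this]; exact isCP_adM 1

lemma IsCP.vec {n : ℕ} {φ : Module.End ℂ (MatC n)} (h : IsCP φ) {m : ℕ}
    (u f : Fin m → (Fin n → ℂ)) :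
    0 ≤ ∑ i, ∑ j, star (f i) ⬝ᵥ ((φ (vecMulVec (u i) (star (u j)))) *ᵥ f j) := by
  rcases Nat.eq_zero_or_pos n with rfl | hn
  · simp [dotProduct]
  · have := h m (fun i => vecMulVec (Pi.single ⟨0, hn⟩ 1) (star (u i))) f
    simpa [conjTranspose_vecMulVec, vecMulVec_mul_vecMulVec] using this

lemma posSemidef_of_form {ι : Type*} [Fintype ι] [DecidableEq ι] (M : Matrix ι ι ℂ)
    (h : ∀ x : ι → ℂ, 0 ≤ star x ⬝ᵥ (M *ᵥ x)) : M.PosSemidef := by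
  rw [← Matrix.isPositive_toEuclideanLin_iff, LinearMap.isPositive_iff_complex]
  intro x
  have h1 := h (WithLp.ofLp x)
  have h2 : inner ℂ (M.toEuclideanLin x) x = star (star (WithLp.ofLp x) ⬝ᵥ (M *ᵥ WithLp.ofLp x)) := by
    rw [EuclideanSpace.inner_eq_star_dotProduct, Matrix.star_dotProduct, star_star, dotProduct_comm]
    simp [Matrix.toLpLin_apply, dotProduct_comm]
  have h3 : star (star (WithLp.ofLp x) ⬝ᵥ (M *ᵥ WithLp.ofLp x))
      = star (WithLp.ofLp x) ⬝ᵥ (M *ᵥ WithLp.ofLp x) := (IsSelfAdjoint.of_nonneg h1)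
  rw [h2, h3]
  rw [Complex.nonneg_iff] at h1
  refine ⟨?_, h1.1⟩
  apply Complex.ext
  · simp
  · simpa using h1.2

lemma IsCP.mul {n : ℕ} {φ χ : Module.End ℂ (MatC n)} (h1 : IsCP φ) (h2 : IsCP χ) :
    IsCP (φ * χ) := by
  intro m A f
  let P : Matrix (Fin m × Fin n) (Fin m × Fin n) ℂ :=
    fun p q => χ ((A p.1)ᴴ * A q.1) p.2 q.2
  have hP : P.PosSemidef := by
    apply posSemidef_of_form
    intro x
    have := h2 m A (fun i a => x (i, a))
    convert this using 1
    simp only [dotProduct, mulVec, Fintype.sum_prod_type, P, Finset.mul_sum, Pi.star_apply]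
    refine Finset.sum_congr rfl fun i _ => ?_
    rw [Finset.sum_comm]
  obtain ⟨N, v, hv⟩ := Matrix.posSemidef_iff_eq_sum_vecMulVec.mp hP
  have hblock : ∀ i j, χ ((A i)ᴴ * A j)
      = ∑ r, vecMulVec (fun a => v r (i, a)) (star (fun a => v r (j, a))) := by
    intro i j
    ext a b
    have := congrFun (congrFun hv (i, a)) (j, b)
    simp only [P] at this
    rw [this]
    simp [Matrix.sum_apply, vecMulVec_apply]
  have : ∑ i, ∑ j, star (f i) ⬝ᵥ (((φ * χ) ((A i)ᴴ * A j)) *ᵥ f j)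
     = ∑ r, ∑ i, ∑ j, star (f i) ⬝ᵥ
       ((φ (vecMulVec (fun a => v r (i, a)) (star (fun a => v r (j, a))))) *ᵥ f j) := by
    rw [eq_comm, Finset.sum_comm]
    refine Finset.sum_congr rfl fun i _ => ?_
    rw [Finset.sum_comm]
    refine Finset.sum_congr rfl fun j _ => ?_
    rw [Module.End.mul_apply, hblock, map_sum, Matrix.sum_mulVec, dotProduct_sum]
  rw [this]
  exact Finset.sum_nonneg fun r _ => h1.vec (fun i a => v r (i, a)) f

lemma IsCP.pow {n : ℕ} {φ : Module.End ℂ (MatC n)} (h : IsCP φ) (k : ℕ) : IsCP (φ ^ k) := by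
  induction k with
  | zero => simpa using isCP_one
  | succ k ih => rw [pow_succ]; exact ih.mul h

/-- Entries of a completely positive map are bounded by the trace of the image of `1`. -/
lemma IsCP.entry_bound {n : ℕ} {φ : Module.End ℂ (MatC n)} (h : IsCP φ) (i j a b : Fin n) :
    ‖φ (Matrix.single i j 1) a b‖ ≤ (φ 1).trace.re := by
  let P : Matrix (Fin n × Fin n) (Fin n × Fin n) ℂ :=
    fun p q => φ (Matrix.single p.1 q.1 1) p.2 q.2
  have hP : P.PosSemidef := by
    apply posSemidef_of_form
    intro x
    have := h.vec (fun i : Fin n => Pi.single i 1) (fun i a => x (i, a))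
    convert this using 1
    have hs : ∀ k l : Fin n, vecMulVec (Pi.single k (1 : ℂ)) (star (Pi.single l (1 : ℂ)))
        = Matrix.single k l 1 := by
      intro k l
      rw [← Pi.single_star, star_one, Matrix.single_eq_single_vecMulVec_single]
    simp only [dotProduct, mulVec, Fintype.sum_prod_type, P, Finset.mul_sum, Pi.star_apply, hs]
    refine Finset.sum_congr rfl fun i _ => ?_
    rw [Finset.sum_comm]
  obtain ⟨N, v, hv⟩ := Matrix.posSemidef_iff_eq_sum_vecMulVec.mp hP
  have hent : ∀ p q, P p q = ∑ r, v r p * star (v r q) := by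
    intro p q
    rw [hv]
    simp [Matrix.sum_apply, vecMulVec_apply]
  have htr : (φ 1).trace = ∑ p, P p p := by
    have h1 : (1 : MatC n) = ∑ i, Matrix.single i i 1 := by
      rw [Matrix.sum_single_one]
    rw [h1, map_sum, Matrix.trace_sum, Fintype.sum_prod_type]
    rfl
  have htr2 : (φ 1).trace.re = ∑ r, ∑ p, ‖v r p‖ ^ 2 := by
    rw [htr, Finset.sum_comm, Complex.re_sum]
    refine Finset.sum_congr rfl fun p _ => ?_
    rw [hent, Complex.re_sum]
    refine Finset.sum_congr rfl fun r _ => ?_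
    rw [Complex.star_def, Complex.mul_conj, Complex.normSq_eq_norm_sq, Complex.ofReal_re]
  have h0 : φ (Matrix.single i j 1) a b = P (i, a) (j, b) := rfl
  rw [h0, hent, htr2]
  refine (norm_sum_le _ _).trans (Finset.sum_le_sum fun r _ => ?_)
  have b1 := Finset.single_le_sum (f := fun p => ‖v r p‖ ^ 2) (fun p _ => sq_nonneg _)
    (Finset.mem_univ (i, a))
  have b2 := Finset.single_le_sum (f := fun p => ‖v r p‖ ^ 2) (fun p _ => sq_nonneg _)
    (Finset.mem_univ (j, b))
  rw [norm_mul, norm_star]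
  nlinarith [sq_nonneg (‖v r (i, a)‖ - ‖v r (j, b)‖)]

lemma IsCP.trace_nonneg {n : ℕ} {φ : Module.End ℂ (MatC n)} (h : IsCP φ) :
    0 ≤ (φ 1).trace := by
  have : (φ 1).trace = ∑ a, star (Pi.single a (1:ℂ)) ⬝ᵥ (φ 1 *ᵥ Pi.single a 1) := by
    simp [Matrix.trace]
  rw [this]
  refine Finset.sum_nonneg fun a _ => ?_
  have := h 1 (fun _ => 1) (fun _ => Pi.single a 1)
  simpa using this

/-- Structure of conditionally negative maps. -/
lemma IsCondNeg.decomp {n : ℕ} {ψ : Module.End ℂ (MatC n)} (h : IsCondNeg ψ) :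
    ∃ (G : MatC n) (K : Module.End ℂ (MatC n)), IsCP K ∧
      ∀ A, ψ A = - (K A + G * A + A * Gᴴ) := by
  rcases Nat.eq_zero_or_pos n with rfl | hn
  · exact ⟨0, 0, isCP_zero, fun A => Subsingleton.elim _ _⟩
  obtain ⟨hsa, hneg⟩ := h
  let o : Fin n := ⟨0, hn⟩
  let e : Fin n → ℂ := Pi.single o 1
  have hee : star e = e := by simp only [e]; rw [← Pi.single_star, star_one]
  let c : ℂ := ψ (vecMulVec e e) o o
  have hc : star c = c := by
    have h1 := hsa (vecMulVec e e)
    rw [conjTranspose_vecMulVec, hee] at h1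
    have := congrFun (congrFun h1 o) o
    rw [conjTranspose_apply] at this
    exact this.symm
  let G : MatC n := Matrix.of (fun k l => - ψ (vecMulVec (Pi.single l 1) e) k o) + (c / 2) • 1
  have hG : ∀ u : Fin n → ℂ, G *ᵥ u = - (ψ (vecMulVec u e) *ᵥ e) + (c / 2) • u := by
    intro u
    have hu : vecMulVec u e = ∑ l, u l • vecMulVec (Pi.single l 1) e := by
      ext a b
      simp [Matrix.sum_apply, vecMulVec_apply, Pi.single_apply]
    ext k
    rw [hu, map_sum]
    simp only [G, e, Matrix.add_mulVec, Matrix.smul_mulVec, one_mulVec, mulVec_single_one,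
      Pi.add_apply, Pi.neg_apply, Matrix.col_apply, Matrix.sum_apply, map_smul, Matrix.smul_apply]
    simp [mulVec, dotProduct, mul_comm]
  have hconj : ∀ (x y : Fin n → ℂ) (M : MatC n), star (star x ⬝ᵥ (M *ᵥ y)) = star y ⬝ᵥ (Mᴴ *ᵥ x) := by
    intro x y M
    rw [Matrix.star_dotProduct, star_star, star_mulVec, ← dotProduct_mulVec]
  refine ⟨G, -ψ - LinearMap.mulLeft ℂ G - LinearMap.mulRight ℂ Gᴴ, ?_, ?_⟩
  · intro m A f
    set v : Fin n → ℂ := ∑ j, A j *ᵥ f j with hv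
    let A0 : MatC n := - vecMulVec v e
    have key := hneg (m + 1) (Fin.cons A0 A) (Fin.cons e f) (by
      rw [Fin.sum_univ_succ]
      simp only [Fin.cons_zero, Fin.cons_succ, ← hv, A0]
      rw [Matrix.neg_mulVec, vecMulVec_mulVec]
      simp [e])
    simp only [Fin.sum_univ_succ, Fin.cons_zero, Fin.cons_succ] at key
    have e1 : star e ⬝ᵥ (ψ (A0ᴴ * A0) *ᵥ e) = (star v ⬝ᵥ v) * c := by
      have : A0ᴴ * A0 = (star v ⬝ᵥ v) • vecMulVec e e := by
        simp [A0, conjTranspose_vecMulVec, hee, vecMulVec_mul_vecMulVec]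
      rw [this, map_smul, Matrix.smul_mulVec, hee]
      simp [e, c]
    have e2 : ∀ i, star (f i) ⬝ᵥ (ψ ((A i)ᴴ * A0) *ᵥ e)
        = (∑ j, star (f i) ⬝ᵥ ((G * ((A i)ᴴ * A j)) *ᵥ f j))
          - c / 2 * (star (A i *ᵥ f i) ⬝ᵥ v) := by
      intro i
      have : (A i)ᴴ * A0 = - vecMulVec ((A i)ᴴ *ᵥ v) e := by
        simp [A0, mul_vecMulVec]
      have h3 := hG ((A i)ᴴ *ᵥ v)
      have h4 : ψ ((A i)ᴴ * A0) *ᵥ e = G *ᵥ ((A i)ᴴ *ᵥ v) - (c / 2) • ((A i)ᴴ *ᵥ v) := by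
        rw [this, h3, map_neg, Matrix.neg_mulVec]; abel
      rw [h4, dotProduct_sub, dotProduct_smul, smul_eq_mul, star_mulVec, ← dotProduct_mulVec]
      congr 1
      rw [← dotProduct_sum]
      congr 1
      rw [hv, Matrix.mulVec_sum, Matrix.mulVec_sum]
      simp [mulVec_mulVec]
    have e3 : ∀ j, star e ⬝ᵥ (ψ (A0ᴴ * A j) *ᵥ f j) = star (star (f j) ⬝ᵥ (ψ ((A j)ᴴ * A0) *ᵥ e)) := by
      intro j
      rw [hconj, ← hsa]
      simp
    have hvv : ∑ i, star (A i *ᵥ f i) ⬝ᵥ v = star v ⬝ᵥ v := by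
      rw [← sum_dotProduct, ← star_sum]
    have hvr : star (star v ⬝ᵥ v) = star v ⬝ᵥ v :=
      IsSelfAdjoint.of_nonneg (dotProduct_star_self_nonneg v)
    set S : ℂ := ∑ i, ∑ j, star (f i) ⬝ᵥ ((G * ((A i)ᴴ * A j)) *ᵥ f j) with hS
    have e4 : ∑ i, star (f i) ⬝ᵥ (ψ ((A i)ᴴ * A0) *ᵥ e) = S - c / 2 * (star v ⬝ᵥ v) := by
      simp only [e2]
      rw [Finset.sum_sub_distrib, ← Finset.mul_sum, hvv]
    have e5 : ∑ j, star e ⬝ᵥ (ψ (A0ᴴ * A j) *ᵥ f j) = star S - c / 2 * (star v ⬝ᵥ v) := by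
      simp only [e3]
      rw [← star_sum, e4, star_sub, star_mul', hvr, star_div₀, hc]
      simp
    have e6 : star S = ∑ i, ∑ j, star (f i) ⬝ᵥ ((((A i)ᴴ * A j) * Gᴴ) *ᵥ f j) := by
      rw [hS, star_sum]
      simp only [star_sum, hconj]
      rw [Finset.sum_comm]
      simp
    rw [Finset.sum_add_distrib, e1, e4, e5] at key
    have e7 : ∑ i, ∑ j, star (f i) ⬝ᵥ (((-ψ - LinearMap.mulLeft ℂ G - LinearMap.mulRight ℂ Gᴴ)
        ((A i)ᴴ * A j)) *ᵥ f j)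
        = -(∑ i, ∑ j, star (f i) ⬝ᵥ (ψ ((A i)ᴴ * A j) *ᵥ f j)) - S - star S := by
      rw [e6, hS]
      simp only [LinearMap.sub_apply, LinearMap.neg_apply, LinearMap.mulLeft_apply,
        LinearMap.mulRight_apply, Matrix.sub_mulVec, Matrix.neg_mulVec, dotProduct_sub,
        dotProduct_neg, Finset.sum_sub_distrib, Finset.sum_neg_distrib]
    rw [e7]
    rw [← neg_nonneg] at key
    convert key using 1
    ring
  · intro A
    simp only [LinearMap.sub_apply, LinearMap.neg_apply, LinearMap.mulLeft_apply,
        LinearMap.mulRight_apply]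
    abel

lemma exists_normedAlg (n : ℕ) : ∃ (𝒜 : Type) (_ : NormedRing 𝒜) (_ : NormedAlgebra ℂ 𝒜),
    Nonempty (Module.End ℂ (MatC n) ≃ₐ[ℂ] 𝒜) :=
  ⟨Matrix (Fin n × Fin n) (Fin n × Fin n) ℂ, Matrix.linftyOpNormedRing,
    Matrix.linftyOpNormedAlgebra, ⟨LinearMap.toMatrixAlgEquiv (Matrix.stdBasis ℂ (Fin n) (Fin n))⟩⟩

lemma neumann {n : ℕ} {𝒜 : Type} [NormedRing 𝒜] [NormedAlgebra ℂ 𝒜]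
    (e : Module.End ℂ (MatC n) ≃ₐ[ℂ] 𝒜) {X : Module.End ℂ (MatC n)} (hX : IsCP X)
    (hs : Summable fun k : ℕ => e X ^ k) :
    ∃ S : Module.End ℂ (MatC n), (1 - X) * S = 1 ∧ S * (1 - X) = 1 ∧ IsCP S := by
  have : FiniteDimensional ℂ 𝒜 := e.toLinearEquiv.finiteDimensional
  refine ⟨e.symm (∑' k : ℕ, e X ^ k), ?_, ?_, ?_⟩
  · apply e.injective
    simpa using hs.one_sub_mul_tsum_pow
  · apply e.injective
    simpa using hs.tsum_pow_mul_one_sub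
  · rw [isCP_iff]
    intro m A f
    let L : 𝒜 →ₗ[ℂ] ℂ := cpForm m A f ∘ₗ e.symm.toLinearMap
    have hL : Continuous L := L.continuous_of_finiteDimensional
    have ht := (hL.tendsto _).comp hs.hasSum.tendsto_sum_nat
    refine ge_of_tendsto' ht fun N => ?_
    have : L (∑ k ∈ Finset.range N, e X ^ k)
        = cpForm m A f (∑ k ∈ Finset.range N, X ^ k) := by
      simp [L]
    simp only [Function.comp]
    rw [this]
    exact isCP_sum _ _ (fun k => hX.pow k) m A f

/-- The map `A ↦ A i j • E_ab`. -/
noncomputable def unitMap {n : ℕ} (i j a b : Fin n) : Module.End ℂ (MatC n) where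
  toFun A := A i j • Matrix.single a b 1
  map_add' A B := by simp [add_smul]
  map_smul' c A := by simp [mul_smul]

lemma expand {n : ℕ} (φ : Module.End ℂ (MatC n)) :
    φ = ∑ i, ∑ j, ∑ a, ∑ b, (φ (Matrix.single i j 1) a b) • unitMap i j a b := by
  ext1 A
  have h1 : ∀ i j, (∑ a, ∑ b, (φ (Matrix.single i j 1) a b) • unitMap i j a b) A
      = A i j • φ (Matrix.single i j 1) := by
    intro i j
    conv_rhs => rw [Matrix.matrix_eq_sum_single (φ (Matrix.single i j 1))]
    simp only [LinearMap.sum_apply, LinearMap.smul_apply, unitMap, LinearMap.coe_mk,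
      AddHom.coe_mk, Finset.smul_sum]
    refine Finset.sum_congr rfl fun a _ => Finset.sum_congr rfl fun b _ => ?_
    rw [Matrix.smul_single, Matrix.smul_single, Matrix.smul_single]
    congr 1
    simp [mul_comm]
  rw [LinearMap.sum_apply]
  simp only [LinearMap.sum_apply] at h1 ⊢
  simp only [h1]
  conv_lhs => rw [Matrix.matrix_eq_sum_single A]
  simp only [map_sum]
  refine Finset.sum_congr rfl fun a _ => Finset.sum_congr rfl fun b _ => ?_
  rw [← map_smul, Matrix.smul_single, smul_eq_mul, mul_one]

/-- Norm bound through entries. -/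
lemma norm_le_trace {n : ℕ} {𝒜 : Type} [NormedRing 𝒜] [NormedAlgebra ℂ 𝒜]
    (e : Module.End ℂ (MatC n) ≃ₐ[ℂ] 𝒜) :
    ∃ C : ℝ, 0 ≤ C ∧ ∀ φ : Module.End ℂ (MatC n), IsCP φ →
    ‖e φ‖ ≤ C * (φ 1).trace.re := by
  refine ⟨∑ i, ∑ j, ∑ a, ∑ b, ‖e (unitMap (n := n) i j a b)‖, by positivity, fun φ hφ => ?_⟩
  have ht : 0 ≤ (φ 1).trace.re := (Complex.nonneg_iff.1 hφ.trace_nonneg).1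
  conv_lhs => rw [expand φ]
  simp only [map_sum, Finset.sum_mul, map_smul]
  refine (norm_sum_le _ _).trans (Finset.sum_le_sum fun i _ => ?_)
  refine (norm_sum_le _ _).trans (Finset.sum_le_sum fun j _ => ?_)
  refine (norm_sum_le _ _).trans (Finset.sum_le_sum fun a _ => ?_)
  refine (norm_sum_le _ _).trans (Finset.sum_le_sum fun b _ => ?_)
  rw [norm_smul, mul_comm]
  exact mul_le_mul_of_nonneg_left (hφ.entry_bound i j a b) (norm_nonneg _)

lemma neumann_of_trace {n : ℕ} {X : Module.End ℂ (MatC n)} (hX : IsCP X) (C r : ℝ) (hr0 : 0 ≤ r)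
    (hr : r < 1) (hb : ∀ k : ℕ, ((X ^ k) 1).trace.re ≤ C * r ^ k) :
    ∃ S : Module.End ℂ (MatC n), (1 - X) * S = 1 ∧ S * (1 - X) = 1 ∧ IsCP S := by
  obtain ⟨𝒜, _, _, ⟨e⟩⟩ := exists_normedAlg n
  have : FiniteDimensional ℂ 𝒜 := e.toLinearEquiv.finiteDimensional
  have : CompleteSpace 𝒜 := FiniteDimensional.complete ℂ 𝒜
  apply neumann e hX
  obtain ⟨D, hD, h⟩ := norm_le_trace e
  refine Summable.of_norm_bounded (g := fun k => (D * C) * r ^ k)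
    ((summable_geometric_of_lt_one hr0 hr).mul_left _) fun k => ?_
  rw [← map_pow, mul_assoc]
  exact (h _ (hX.pow k)).trans (mul_le_mul_of_nonneg_left (hb k) hD)

/-- Smallness of the Neumann variable in a general Banach algebra. -/
lemma small_aux {𝒜 : Type} [NormedRing 𝒜] [NormedAlgebra ℂ 𝒜] [CompleteSpace 𝒜] (l g k : 𝒜) :
    ∃ ε : ℝ, 0 < ε ∧ ∀ s : ℝ, 0 < s → s < ε →
      IsUnit (1 - (s : ℂ) • l + ((s : ℂ) * s) • g) ∧
      ‖(s : ℂ) • (Ring.inverse (1 - (s : ℂ) • l + ((s : ℂ) * s) • g) * (k + (s : ℂ) • g))‖ < 1 := by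
  have hc1 : Continuous fun s : ℝ => 1 - (s : ℂ) • l + ((s : ℂ) * s) • g := by fun_prop
  have hunit : ∀ᶠ s : ℝ in nhds 0, IsUnit (1 - (s : ℂ) • l + ((s : ℂ) * s) • g) := by
    have := hc1.tendsto 0
    refine this.eventually (Units.isOpen.mem_nhds ?_)
    simp
  have hBc : ContinuousAt (fun s : ℝ => Ring.inverse (1 - (s : ℂ) • l + ((s : ℂ) * s) • g)) 0 := by
    have h1 : ContinuousAt (Ring.inverse : 𝒜 → 𝒜) 1 := by
      simpa using NormedRing.inverse_continuousAt (1 : 𝒜ˣ)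
    exact ContinuousAt.comp_of_eq h1 hc1.continuousAt (by simp)
  have h2 : ContinuousAt (fun s : ℝ => (s : ℂ)) 0 := Complex.continuous_ofReal.continuousAt
  have hXc := (h2.smul (hBc.mul ((continuousAt_const (y := k)).add
    (h2.smul (continuousAt_const (y := g)))))).norm
  have hsmall := hXc.eventually_lt (continuousAt_const (y := (1 : ℝ))) (by simp)
  obtain ⟨ε, hε, hball⟩ := Metric.eventually_nhds_iff.1 (hunit.and hsmall)
  refine ⟨ε, hε, fun s hs hsε => hball (y := s) ?_⟩
  rw [Real.dist_eq, sub_zero, abs_of_pos hs]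
  exact hsε

/-- For large `T`, `ψ + T` has a completely positive inverse. -/
lemma IsCondNeg.large {n : ℕ} {ψ : Module.End ℂ (MatC n)} (h : IsCondNeg ψ) :
    ∃ T₀ : ℝ, ∀ T : ℝ, T₀ ≤ T → ∃ S : Module.End ℂ (MatC n),
      (ψ + (T : ℂ) • 1) * S = 1 ∧ S * (ψ + (T : ℂ) • 1) = 1 ∧ IsCP S := by
  obtain ⟨G, K, hK, hψ⟩ := h.decomp
  obtain ⟨𝒜, _, _, ⟨e⟩⟩ := exists_normedAlg n
  have : FiniteDimensional ℂ 𝒜 := e.toLinearEquiv.finiteDimensional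
  have : CompleteSpace 𝒜 := FiniteDimensional.complete ℂ 𝒜
  obtain ⟨ε, hε, hball⟩ := small_aux
    (e (LinearMap.mulLeft ℂ G + LinearMap.mulRight ℂ Gᴴ)) (e (adM G)) (e K)
  refine ⟨ε⁻¹ + 1, fun T hT => ?_⟩
  have hTpos : 0 < T := by have := inv_pos.2 hε; linarith
  have hs0 : 0 < T⁻¹ := inv_pos.2 hTpos
  obtain ⟨hu, hn⟩ := hball T⁻¹ hs0 (inv_lt_of_inv_lt₀ hε (by linarith))
  set s : ℝ := T⁻¹ with hs
  have hcs : (starRingEnd ℂ) (s : ℂ) = s := Complex.conj_ofReal s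
  have hadm : ∀ M N : MatC n, adM M * adM N = adM (M * N) := by
    intro M N; ext1 A; simp [adM_apply, mul_assoc]
  have had1 : adM (1 : MatC n) = 1 := by ext1 A; simp [adM_apply]
  let M : MatC n := 1 - (s : ℂ) • G
  have hadM : adM M = 1 - (s : ℂ) • (LinearMap.mulLeft ℂ G + LinearMap.mulRight ℂ Gᴴ)
      + ((s : ℂ) * s) • adM G := by
    ext1 A
    simp only [M, LinearMap.add_apply, LinearMap.sub_apply, LinearMap.smul_apply,
      Module.End.one_apply, adM_apply, conjTranspose_sub, conjTranspose_smul,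
      conjTranspose_one, Complex.star_def, hcs, sub_mul, mul_sub, one_mul, mul_one,
      smul_mul_assoc, mul_smul_comm, smul_sub, smul_add, smul_smul, LinearMap.mulLeft_apply,
      LinearMap.mulRight_apply]
    abel
  have heM : e (adM M) = 1 - (s : ℂ) • e (LinearMap.mulLeft ℂ G + LinearMap.mulRight ℂ Gᴴ)
      + ((s : ℂ) * s) • e (adM G) := by
    rw [hadM, map_add, map_sub, map_one, map_smul, map_smul]
  rw [← heM] at hu hn
  have hu' : IsUnit (adM M) := by
    have := hu.map e.symm
    simpa using this
  obtain ⟨B, hBr⟩ : ∃ B, M * B = 1 := by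
    refine ⟨Ring.inverse (adM M) 1 * Mᴴ, ?_⟩
    have := LinearMap.congr_fun (Ring.mul_inverse_cancel _ hu') 1
    rw [Module.End.mul_apply, adM_apply, Module.End.one_apply] at this
    rw [← mul_assoc]; exact this
  have hBl : B * M = 1 := mul_eq_one_comm.1 hBr
  have hinvE : Ring.inverse (e (adM M)) = e (adM B) := by
    have h1 : e (adM B) * e (adM M) = 1 := by rw [← map_mul, hadm, hBl, had1, map_one]
    calc Ring.inverse (e (adM M)) = e (adM B) * e (adM M) * Ring.inverse (e (adM M)) := by
          rw [h1, one_mul]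
      _ = e (adM B) := Ring.mul_inverse_cancel_right _ _ hu
  let Y : Module.End ℂ (MatC n) := K + (s : ℂ) • adM G
  let X : Module.End ℂ (MatC n) := (s : ℂ) • (adM B * Y)
  have hXn : ‖e X‖ < 1 := by
    have : e X = (s : ℂ) • (Ring.inverse (e (adM M)) * (e K + (s : ℂ) • e (adM G))) := by
      rw [hinvE]
      simp only [X, Y, map_smul, map_mul, map_add]
    rw [this]; exact hn
  have hXcp : IsCP X :=
    ((isCP_adM _).mul (hK.add ((isCP_adM G).smul hs0.le))).smul hs0.le
  obtain ⟨S, hS1, hS2, hS⟩ := neumann e hXcp (summable_geometric_of_norm_lt_one hXn)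
  have hT1 : (T : ℂ) * (s : ℂ) = 1 := by
    rw [hs]; push_cast; exact mul_inv_cancel₀ (by exact_mod_cast hTpos.ne')
  have hfac : ψ + (T : ℂ) • 1 = (T : ℂ) • (adM M * (1 - X)) := by
    have h1 : adM M * X = (s : ℂ) • Y := by
      simp only [X]
      rw [mul_smul_comm, ← mul_assoc, hadm, hBr, had1, one_mul]
    rw [mul_sub, h1, mul_one, hadM]
    ext1 A
    simp only [Y, LinearMap.add_apply, LinearMap.sub_apply, LinearMap.smul_apply,
      Module.End.one_apply, hψ, smul_sub, smul_add, smul_smul, ← mul_assoc, hT1, one_smul,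
      one_mul, LinearMap.mulLeft_apply, LinearMap.mulRight_apply]
    abel
  refine ⟨(s : ℂ) • (S * adM B), ?_, ?_, (hS.mul (isCP_adM _)).smul hs0.le⟩
  · rw [hfac, smul_mul_smul_comm, hT1, one_smul, mul_assoc, ← mul_assoc (1 - X), hS1, one_mul,
      hadm, hBr, had1]
  · rw [hfac, smul_mul_smul_comm, mul_comm (s : ℂ), hT1, one_smul, mul_assoc,
      ← mul_assoc (adM B), hadm, hBl, had1, one_mul, hS2]

lemma resolvent_one {n : ℕ} {φ₁ ψ₁ : Module.End ℂ (MatC n)}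
    (hinv : φ₁ * ψ₁ = 1 ∧ ψ₁ * φ₁ = 1) (hq : NoNegEig φ₁) {t : ℝ} (ht : 0 ≤ t) :
    (ψ₁ + (t : ℂ) • 1) * qRes φ₁ t = 1 ∧ qRes φ₁ t * (ψ₁ + (t : ℂ) • 1) = 1 := by
  have hu : IsUnit (1 + (t : ℂ) • φ₁) := by
    rcases ht.eq_or_lt with rfl | hpos
    · simp
    · rw [LinearMap.isUnit_iff_ker_eq_bot, LinearMap.ker_eq_bot']
      intro x hx
      by_contra hne
      have ht0 : (t : ℂ) ≠ 0 := by exact_mod_cast hpos.ne'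
      refine hq (-t⁻¹) (by have := inv_pos.2 hpos; linarith) ?_
      refine Module.End.hasEigenvalue_of_hasEigenvector (x := x)
        (Module.End.hasEigenvector_iff.2 ⟨?_, hne⟩)
      rw [Module.End.mem_eigenspace_iff]
      simp only [LinearMap.add_apply, LinearMap.smul_apply, Module.End.one_apply] at hx
      have h2 : (t : ℂ) • φ₁ x = - x := by rw [eq_neg_iff_add_eq_zero, add_comm]; exact hx
      have h3 : φ₁ x = (t : ℂ)⁻¹ • ((t : ℂ) • φ₁ x) := by
        rw [smul_smul, inv_mul_cancel₀ ht0, one_smul]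
      rw [h3, h2]; push_cast; simp
  have h1 : (ψ₁ + (t : ℂ) • 1) * φ₁ = 1 + (t : ℂ) • φ₁ := by
    rw [add_mul, hinv.2, smul_mul_assoc, one_mul]
  have h2 : (ψ₁ + (t : ℂ) • 1) * qRes φ₁ t = 1 := by
    rw [qRes, ← mul_assoc, h1, Ring.mul_inverse_cancel _ hu]
  exact ⟨h2, mul_eq_one_comm.1 h2⟩

lemma diff_cp {n : ℕ} {a b R₁ R₂ : Module.End ℂ (MatC n)} (h1 : R₁ * a = 1) (h2 : b * R₂ = 1)
    (hR₁ : IsCP R₁) (hR₂ : IsCP R₂) (hab : IsCP (b - a)) : IsCP (R₁ - R₂) := by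
  have : R₁ - R₂ = R₁ * (b - a) * R₂ := by
    rw [mul_sub, sub_mul, h1, one_mul, mul_assoc, h2, mul_one]
  rw [this]
  exact (hR₁.mul hab).mul hR₂

lemma pow_diff_cp {n : ℕ} {R₁ R₂ : Module.End ℂ (MatC n)}
    (hR₁ : IsCP R₁) (hR₂ : IsCP R₂) (h : IsCP (R₁ - R₂)) (k : ℕ) : IsCP (R₁ ^ k - R₂ ^ k) := by
  induction k with
  | zero => simpa using isCP_zero
  | succ k ih =>
    have : R₁ ^ (k + 1) - R₂ ^ (k + 1) = R₁ ^ k * (R₁ - R₂) + (R₁ ^ k - R₂ ^ k) * R₂ := by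
      rw [pow_succ, pow_succ, mul_sub, sub_mul]; abel
    rw [this]
    exact ((hR₁.pow k).mul h).add (ih.mul hR₂)

lemma main_resolvent {n : ℕ} (φ₁ ψ₁ ψ₂ : Module.End ℂ (MatC n))
    (hinv : φ₁ * ψ₁ = 1 ∧ ψ₁ * φ₁ = 1) (hone : φ₁ 1 = 1) (hq : IsQPos φ₁)
    (hcn : IsCondNeg ψ₂) (hcp : IsCP (ψ₂ - ψ₁)) (t : ℝ) (ht : 0 ≤ t) :
    ∃ S : Module.End ℂ (MatC n),
      (ψ₂ + (t : ℂ) • 1) * S = 1 ∧ S * (ψ₂ + (t : ℂ) • 1) = 1 ∧ IsCP S := by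
  obtain ⟨T₀, hT₀⟩ := hcn.large
  let T : ℝ := max T₀ t
  have hTt : t ≤ T := le_max_right _ _
  have hT0 : 0 ≤ T := ht.trans hTt
  obtain ⟨R₂, hl, hr, hR₂⟩ := hT₀ T (le_max_left _ _)
  obtain ⟨hl1, hr1⟩ := resolvent_one hinv hq.1 hT0
  set R₁ := qRes φ₁ T with hR₁def
  have hR₁ : IsCP R₁ := hq.2 T hT0
  have hd : IsCP (R₁ - R₂) := diff_cp hr1 hl hR₁ hR₂ (by simpa using hcp)
  have hψ1 : ψ₁ 1 = 1 := by
    have := LinearMap.congr_fun hinv.2 1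
    simpa [hone] using this
  have hc0 : ((1 + T : ℝ) : ℂ) ≠ 0 := by
    have : (1 + T : ℝ) ≠ 0 := by positivity
    exact_mod_cast this
  have hR1one : R₁ 1 = (((1 + T)⁻¹ : ℝ) : ℂ) • (1 : MatC n) := by
    have h1 := LinearMap.congr_fun hr1 1
    have h2 : (ψ₁ + (T : ℂ) • 1) (1 : MatC n) = ((1 + T : ℝ) : ℂ) • (1 : MatC n) := by
      simp [hψ1, add_smul]
    rw [Module.End.mul_apply, h2, map_smul, Module.End.one_apply] at h1
    rw [← h1, smul_smul, h1, Complex.ofReal_inv, inv_mul_cancel₀ hc0, one_smul]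
  have hR1pow : ∀ k : ℕ, (R₁ ^ k) 1 = ((((1 + T)⁻¹) ^ k : ℝ) : ℂ) • (1 : MatC n) := by
    intro k
    induction k with
    | zero => simp
    | succ k ih =>
      rw [pow_succ', Module.End.mul_apply, ih, map_smul, hR1one, smul_smul, pow_succ]
      push_cast; rfl
  have htr : ∀ k : ℕ, ((R₂ ^ k) 1).trace.re ≤ n * ((1 + T)⁻¹) ^ k := by
    intro k
    have h1 := (Complex.nonneg_iff.1 (pow_diff_cp hR₁ hR₂ hd k).trace_nonneg).1
    rw [LinearMap.sub_apply, Matrix.trace_sub, Complex.sub_re, hR1pow, Matrix.trace_smul,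
      Matrix.trace_one, smul_eq_mul, Complex.re_ofReal_mul] at h1
    simp at h1
    simp only [inv_pow]
    linarith
  have hX : IsCP (((T - t : ℝ) : ℂ) • R₂) := hR₂.smul (by linarith)
  obtain ⟨S, hS1, hS2, hS⟩ := neumann_of_trace hX n ((T - t) * (1 + T)⁻¹)
    (mul_nonneg (by linarith) (by positivity))
    (by rw [← div_eq_mul_inv, div_lt_one (by linarith)]; linarith)
    (fun k => by
      rw [smul_pow, LinearMap.smul_apply, Matrix.trace_smul, smul_eq_mul, ← Complex.ofReal_pow,
        Complex.re_ofReal_mul, mul_pow]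
      have := mul_le_mul_of_nonneg_left (htr k) (pow_nonneg (sub_nonneg.2 hTt) k)
      linarith)
  have hfac : ψ₂ + (t : ℂ) • 1 = (ψ₂ + (T : ℂ) • 1) * (1 - ((T - t : ℝ) : ℂ) • R₂) := by
    rw [mul_sub, mul_one, mul_smul_comm, hl]
    rw [Complex.ofReal_sub, sub_smul (T : ℂ) (t : ℂ) (1 : Module.End ℂ (MatC n))]; abel
  refine ⟨S * R₂, ?_, ?_, hS.mul hR₂⟩
  · rw [hfac, mul_assoc, ← mul_assoc _ S, hS1, one_mul, hl]
  · rw [hfac, mul_assoc, ← mul_assoc R₂, hr, one_mul, hS2]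

/-- If `φ₁` is invertible unital q-positive with inverse `ψ₁`, `ψ₂` is conditionally
negative and `ψ₂ − ψ₁` is completely positive, then `ψ₂` is invertible and
`φ₁ ≥_q ψ₂⁻¹ ≥_q 0`. -/
theorem stmt10 {n : ℕ} (φ₁ ψ₁ ψ₂ : Module.End ℂ (MatC n))
    (hinv : φ₁ * ψ₁ = 1 ∧ ψ₁ * φ₁ = 1) (hone : φ₁ 1 = 1) (hq : IsQPos φ₁)
    (hcn : IsCondNeg ψ₂) (hcp : IsCP (ψ₂ - ψ₁)) :
    IsUnit ψ₂ ∧ IsQPos (Ring.inverse ψ₂) ∧ qLE (Ring.inverse ψ₂) φ₁ := by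
  have main := main_resolvent φ₁ ψ₁ ψ₂ hinv hone hq hcn hcp
  have hu2 : IsUnit ψ₂ := by
    obtain ⟨S, h1, h2, -⟩ := main 0 le_rfl
    simp only [Complex.ofReal_zero, zero_smul, add_zero] at h1 h2
    exact ⟨⟨ψ₂, S, h1, h2⟩, rfl⟩
  set φ₂ := Ring.inverse ψ₂ with hφ₂
  have hi : φ₂ * ψ₂ = 1 ∧ ψ₂ * φ₂ = 1 :=
    ⟨Ring.inverse_mul_cancel _ hu2, Ring.mul_inverse_cancel _ hu2⟩
  have hno : NoNegEig φ₂ := by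
    intro r hr he
    obtain ⟨x, hx⟩ := he.exists_hasEigenvector
    have hx1 := hx.apply_eq_smul
    have hr0 : (r : ℂ) ≠ 0 := by exact_mod_cast hr.ne
    have hx2 : x = (r : ℂ) • ψ₂ x := by
      have := LinearMap.congr_fun hi.2 x
      rw [Module.End.mul_apply, hx1, map_smul, Module.End.one_apply] at this
      exact this.symm
    obtain ⟨S, h1, h2, -⟩ := main (-r⁻¹) (by have := inv_lt_zero.2 hr; linarith)
    have h3 : (ψ₂ + ((-r⁻¹ : ℝ) : ℂ) • 1) x = 0 := by
      have h4 : ψ₂ x = (r : ℂ)⁻¹ • x := by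
        rw [hx2, smul_smul, ← hx2, inv_mul_cancel₀ hr0, one_smul]
      simp [h4]
    have h5 := LinearMap.congr_fun h2 x
    rw [Module.End.mul_apply, h3, map_zero, Module.End.one_apply] at h5
    exact hx.2 h5.symm
  have hcp2 : ∀ t : ℝ, 0 ≤ t → IsCP (qRes φ₂ t) := by
    intro t ht
    obtain ⟨S, h1, h2, hS⟩ := main t ht
    have h3 := (resolvent_one hi hno ht).1
    have : qRes φ₂ t = S := by
      calc qRes φ₂ t = S * (ψ₂ + (t : ℂ) • 1) * qRes φ₂ t := by rw [h2, one_mul]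
        _ = S := by rw [mul_assoc, h3, mul_one]
    rw [this]; exact hS
  refine ⟨hu2, ⟨hno, hcp2⟩, fun t ht => ?_⟩
  exact diff_cp (resolvent_one hinv hq.1 ht).2 (resolvent_one hi hno ht).1 (hq.2 t ht) (hcp2 t ht)
    (by simpa using hcp)
end

section
/- Let ξ: Mₙ(ℂ) → Mₙ(ℂ) be an invertible unital q-positive map. If φ: Mₙ(ℂ) → Mₙ(ℂ) is q-positive and ξ ≥_q φ, then φ is either invertible or identically zero. -/
open scoped ComplexOrder BigOperators
open Matrix

open scoped MatrixOrder Matrix.Norms.L2Operator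
open Filter Topology

/-- The Choi matrix, as a linear map. -/
def choiL (n : ℕ) : Module.End ℂ (MatC n) →ₗ[ℂ]
    Matrix (Fin n × Fin n) (Fin n × Fin n) ℂ where
  toFun φ := Matrix.of fun a b => φ (Matrix.single a.1 b.1 1) a.2 b.2
  map_add' x y := by ext; simp
  map_smul' c x := by ext; simp

lemma choiL_apply {n : ℕ} (φ : Module.End ℂ (MatC n)) (a b : Fin n × Fin n) :
    choiL n φ a b = φ (Matrix.single a.1 b.1 1) a.2 b.2 := rfl

lemma choiL_injective (n : ℕ) : Function.Injective (choiL n) := by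
  intro φ ψ h
  apply (Matrix.stdBasis ℂ (Fin n) (Fin n)).ext
  rintro ⟨i, j⟩
  rw [Matrix.stdBasis_eq_single]
  ext k l
  exact congrFun (congrFun h (i, k)) (j, l)

lemma choiL_one {n : ℕ} (a b : Fin n × Fin n) :
    choiL n 1 a b = (if a.1 = a.2 then 1 else 0) * (if b.1 = b.2 then 1 else 0) := by
  rw [choiL_apply]
  simp only [Module.End.one_apply, Matrix.single_apply]
  split_ifs <;> simp_all

lemma posSemidef_of_nonneg {ι : Type*} [Fintype ι] [DecidableEq ι] (A : Matrix ι ι ℂ)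
    (h : ∀ x : ι → ℂ, 0 ≤ star x ⬝ᵥ (A *ᵥ x)) : A.PosSemidef := by
  rw [← Matrix.isPositive_toEuclideanLin_iff, LinearMap.isPositive_iff_complex]
  intro x
  have h1 := h x.ofLp
  have h2 : inner ℂ (Matrix.toEuclideanLin A x) x = star (star x.ofLp ⬝ᵥ (A *ᵥ x.ofLp)) := by
    rw [EuclideanSpace.inner_eq_star_dotProduct]
    rw [← Matrix.star_dotProduct_star, star_star, dotProduct_comm]
    rfl
  have h3 : star (star x.ofLp ⬝ᵥ (A *ᵥ x.ofLp)) = star x.ofLp ⬝ᵥ (A *ᵥ x.ofLp) :=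
    (IsSelfAdjoint.of_nonneg h1)
  rw [h2, h3]
  rw [Complex.le_def] at h1
  refine ⟨?_, h1.1⟩
  apply Complex.ext
  · simp
  · simpa using h1.2

lemma choi_posSemidef {n : ℕ} (φ : Module.End ℂ (MatC n)) (h : IsCP φ) :
    (choiL n φ).PosSemidef := by
  apply posSemidef_of_nonneg
  intro x
  rcases Nat.eq_zero_or_pos n with rfl | hn
  · simp [dotProduct]
  let z : Fin n := ⟨0, hn⟩
  let e : Fin (Fintype.card (Fin n × Fin n)) ≃ Fin n × Fin n := (Fintype.equivFin _).symm
  have := h _ (fun i => Matrix.single z (e i).1 1) (fun i => Pi.single (e i).2 (x (e i)))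
  convert this using 1
  simp only [Matrix.conjTranspose_single, star_one, Matrix.single_mul_single_same, mul_one]
  have key : ∀ a b : Fin n × Fin n,
      star (Pi.single a.2 (x a) : Fin n → ℂ) ⬝ᵥ
        (φ (Matrix.single a.1 b.1 1) *ᵥ (Pi.single b.2 (x b) : Fin n → ℂ))
      = star (x a) * (choiL n φ a b * x b) := by
    intro a b
    rw [choiL_apply, ← Pi.single_star, single_dotProduct, Matrix.mulVec_single]
    simp
  simp only [key]
  rw [e.sum_comp (fun a => ∑ j, star (x a) * (choiL n φ a (e j) * x (e j)))]
  simp only [dotProduct, Matrix.mulVec, Finset.mul_sum, Pi.star_apply]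
  refine Finset.sum_congr rfl fun a _ => ?_
  rw [e.sum_comp (fun b => star (x a) * (choiL n φ a b * x b))]

lemma choi_extremal {n : ℕ} (M : Matrix (Fin n × Fin n) (Fin n × Fin n) ℂ)
    (h0 : M.PosSemidef) (h1 : (choiL n 1 - M).PosSemidef) :
    ∃ c : ℂ, M = choiL n (c • 1) := by
  have hk : ∀ x, choiL n 1 *ᵥ x = 0 → M *ᵥ x = 0 := by
    intro x hx
    rw [← h0.dotProduct_mulVec_zero_iff]
    have a := h0.dotProduct_mulVec_nonneg x
    have b := h1.dotProduct_mulVec_nonneg x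
    rw [Matrix.sub_mulVec, hx, zero_sub, dotProduct_neg] at b
    exact le_antisymm (neg_nonneg.mp b) a
  have hoff : ∀ a b, b.1 ≠ b.2 → M a b = 0 := by
    intro a b hb
    have := hk (Pi.single b 1) (by
      rw [Matrix.mulVec_single_one]; ext c; simp [choiL_one, hb])
    rw [Matrix.mulVec_single_one] at this
    exact congrFun this a
  have hdiag : ∀ a i j, M a (i, i) = M a (j, j) := by
    intro a i j
    have := hk (Pi.single (i, i) 1 - Pi.single (j, j) 1) (by
      rw [Matrix.mulVec_sub, Matrix.mulVec_single_one, Matrix.mulVec_single_one]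
      ext c; simp [choiL_one])
    rw [Matrix.mulVec_sub, Matrix.mulVec_single_one, Matrix.mulVec_single_one] at this
    exact sub_eq_zero.mp (congrFun this a)
  have hh : ∀ a b, M a b = star (M b a) := fun a b => (h0.isHermitian.apply a b).symm
  rcases Nat.eq_zero_or_pos n with rfl | hn
  · exact ⟨0, by ext a; exact a.1.elim0⟩
  let z : Fin n := ⟨0, hn⟩
  refine ⟨M (z, z) (z, z), ?_⟩
  ext ⟨i, k⟩ ⟨j, l⟩
  rw [map_smul, Matrix.smul_apply, choiL_one]
  by_cases hjl : j = l
  · by_cases hik : i = k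
    · subst hjl hik
      simp only [if_true, mul_one, smul_eq_mul]
      rw [hdiag _ j z, hh, hdiag _ i z, ← hh]
    · rw [hh, hoff _ (i, k) hik]; simp [hik]
  · rw [hoff _ (j, l) hjl]; simp [hjl]

lemma isUnit_one_add {n : ℕ} (φ : Module.End ℂ (MatC n)) (h : NoNegEig φ) (t : ℝ) (ht : 0 < t) :
    IsUnit (1 + (t : ℂ) • φ) := by
  have htc : (t : ℂ) ≠ 0 := by exact_mod_cast ht.ne'
  have h1 := h (-t⁻¹) (by simpa using ht)
  rw [Module.End.hasEigenvalue_iff_mem_spectrum, spectrum.mem_iff, not_not] at h1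
  have h2 : (1 + (t : ℂ) • φ) = (Units.mk0 (-(t : ℂ)) (neg_ne_zero.mpr htc)) •
      (algebraMap ℂ (Module.End ℂ (MatC n)) ((-t⁻¹ : ℝ) : ℂ) - φ) := by
    rw [Units.smul_def, Units.val_mk0, smul_sub, Algebra.algebraMap_eq_smul_one, smul_smul]
    push_cast
    rw [neg_mul_neg, mul_inv_cancel₀ htc, one_smul, neg_smul, sub_neg_eq_add]
  rw [h2]
  exact h1.smul _

theorem stmt15 {n : ℕ} (ξ φ : Module.End ℂ (MatC n))
    (hinv : IsUnit ξ) (hone : ξ 1 = 1) (hqξ : IsQPos ξ)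
    (hqφ : IsQPos φ) (hle : qLE φ ξ) :
    IsUnit φ ∨ φ = 0 := by
  let e := Module.End.toContinuousLinearMap (𝕜 := ℂ) (MatC n)
  have he : ∀ x, IsUnit (e x) ↔ IsUnit x := fun x => MulEquiv.isUnit_map e
  let T : ℕ → ℝ := fun k => (k : ℝ) + 1
  have hT : ∀ k, 0 < T k := fun k => by positivity
  have hTc : ∀ k, (T k : ℂ) ≠ 0 := fun k => by exact_mod_cast (hT k).ne'
  have hTlim : Tendsto (fun k => ((T k : ℂ))⁻¹) atTop (𝓝 0) := by
    have := (tendsto_one_div_add_atTop_nhds_zero_nat (𝕜 := ℂ))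
    refine this.congr fun k => ?_
    simp [T]
  let Q : ℕ → Module.End ℂ (MatC n) := fun k => (T k : ℂ) • qRes ξ (T k)
  let P : ℕ → Module.End ℂ (MatC n) := fun k => (T k : ℂ) • qRes φ (T k)
  -- `Q k → 1`
  have hQ : Tendsto (fun k => e (Q k)) atTop (𝓝 1) := by
    obtain ⟨u, hu⟩ := hinv
    let v : Module.End ℂ (MatC n) := ↑u⁻¹
    have huv : ξ * v = 1 := by rw [← hu]; exact u.mul_inv
    have hQv : ∀ k, Q k * (1 + (T k : ℂ)⁻¹ • v) = 1 := by
      intro k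
      have h1 := isUnit_one_add ξ hqξ.1 (T k) (hT k)
      have h2 : (1 + (T k : ℂ)⁻¹ • v) = (1 + (T k : ℂ) • ξ) * ((T k : ℂ)⁻¹ • v) := by
        rw [add_mul, one_mul, smul_mul_smul_comm, huv, mul_inv_cancel₀ (hTc k), one_smul, add_comm]
      rw [h2]
      simp only [Q, qRes]
      rw [smul_mul_assoc, mul_assoc, Ring.inverse_mul_cancel_left _ _ h1, mul_smul_comm, huv,
        smul_smul, mul_inv_cancel₀ (hTc k), one_smul]
    have hQe : ∀ k, e (Q k) = Ring.inverse (1 + (T k : ℂ)⁻¹ • e v) := by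
      intro k
      have h1 : e (Q k) * (1 + (T k : ℂ)⁻¹ • e v) = 1 := by
        have := congrArg e (hQv k)
        simpa using this
      have h2 : IsUnit (1 + (T k : ℂ)⁻¹ • e v) := by
        have : (1 + (T k : ℂ)⁻¹ • e v) = e (1 + (T k : ℂ)⁻¹ • v) := by simp
        rw [this, he]
        exact IsUnit.of_mul_eq_one_right _ (hQv k)
      rw [Ring.eq_mul_inverse_iff_mul_eq _ 1 _ h2 |>.mpr h1, one_mul]
    simp only [hQe]
    have h3 : Tendsto (fun k => 1 + (T k : ℂ)⁻¹ • e v) atTop (𝓝 1) := by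
      have := (hTlim.smul_const (e v)).const_add 1
      simpa using this
    have h4 := NormedRing.inverse_continuousAt (R := MatC n →L[ℂ] MatC n) 1
    have h5 := h4.tendsto.comp (by simpa using h3)
    simpa [Function.comp_def] using h5
  -- continuity of the Choi map
  let C : (MatC n →L[ℂ] MatC n) →ₗ[ℂ] Matrix (Fin n × Fin n) (Fin n × Fin n) ℂ :=
    choiL n ∘ₗ e.symm.toLinearMap
  have hCe : ∀ x, C (e x) = choiL n x := fun x => by simp [C]
  have hCinj : Function.Injective C := (choiL_injective n).comp e.symm.injective
  have hCemb : IsClosedEmbedding C :=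
    LinearMap.isClosedEmbedding_of_injective (LinearMap.ker_eq_bot.mpr hCinj)
  have hCQ : Tendsto (fun k => choiL n (Q k)) atTop (𝓝 (choiL n 1)) := by
    have := (hCemb.continuous.tendsto 1).comp hQ
    rw [← map_one e, hCe] at this
    simpa [Function.comp_def, hCe] using this
  have hTnn : ∀ k, (0 : ℂ) ≤ (T k : ℂ) := fun k => by exact_mod_cast (hT k).le
  have hP0 : ∀ k, (choiL n (P k)).PosSemidef := fun k => by
    simp only [P, map_smul]
    exact (choi_posSemidef _ (hqφ.2 _ (hT k).le)).smul (hTnn k)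
  have hP1 : ∀ k, (choiL n (Q k) - choiL n (P k)).PosSemidef := fun k => by
    simp only [P, Q, map_smul]
    rw [← smul_sub, ← map_sub]
    exact (choi_posSemidef _ (hle _ (hT k).le)).smul (hTnn k)
  obtain ⟨B, hB⟩ := (Metric.isBounded_range_of_tendsto _ hCQ).exists_norm_le
  have hPB : ∀ k, choiL n (P k) ∈ Metric.closedBall
      (0 : Matrix (Fin n × Fin n) (Fin n × Fin n) ℂ) B := fun k => by
    rw [mem_closedBall_zero_iff]
    refine le_trans ?_ (hB _ ⟨k, rfl⟩)
    exact CStarAlgebra.norm_le_norm_of_nonneg_of_le (hP0 k).nonneg (Matrix.le_iff.mpr (hP1 k))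
  have : ProperSpace (Matrix (Fin n × Fin n) (Fin n × Fin n) ℂ) := FiniteDimensional.proper ℂ _
  obtain ⟨M, -, s, hs, hM⟩ := tendsto_subseq_of_bounded Metric.isBounded_closedBall hPB
  have hcl : ∀ (A : ℕ → Matrix (Fin n × Fin n) (Fin n × Fin n) ℂ) (L), (∀ k, (A k).PosSemidef) →
      Tendsto A atTop (𝓝 L) → L.PosSemidef := by
    intro A L hA hL
    apply posSemidef_of_nonneg
    intro x
    have hc : Continuous fun A : Matrix (Fin n × Fin n) (Fin n × Fin n) ℂ =>
      star x ⬝ᵥ (A *ᵥ x) := by fun_prop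
    exact ge_of_tendsto' ((hc.tendsto L).comp hL) fun k => (hA k).dotProduct_mulVec_nonneg x
  obtain ⟨c, hc⟩ := choi_extremal M (hcl _ _ (fun k => hP0 (s k)) hM)
    (hcl _ _ (fun k => hP1 (s k)) ((hCQ.comp hs.tendsto_atTop).sub hM))
  have hPlim : Tendsto (fun k => e (P (s k))) atTop (𝓝 (c • 1)) := by
    rw [hCemb.isInducing.tendsto_nhds_iff]
    have h1 : C (c • 1) = M := by rw [hc, ← hCe]; simp
    rw [h1]
    simpa [Function.comp_def, hCe] using hM
  by_cases hc1 : c = 1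
  · left
    rw [hc1, one_smul] at hPlim
    have := hPlim.eventually (Units.isOpen.mem_nhds (isUnit_one))
    obtain ⟨k, hk⟩ := this.exists
    have hk : IsUnit (P (s k)) := (he _).mp hk
    simp only [P, qRes] at hk
    rw [← mul_smul_comm] at hk
    exact isUnit_of_mul_isUnit_left hk
  · right
    have hid : ∀ k, φ * (1 - P k) = (T k : ℂ)⁻¹ • P k := by
      intro k
      have h1 := Ring.mul_inverse_cancel _ (isUnit_one_add φ hqφ.1 (T k) (hT k))
      rw [add_mul, one_mul, smul_mul_assoc] at h1
      simp only [P, qRes]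
      rw [smul_smul, inv_mul_cancel₀ (hTc k), one_smul]
      congr 1
      exact sub_eq_of_eq_add h1.symm
    have hl : Tendsto (fun k => e φ * (1 - e (P (s k)))) atTop (𝓝 (e φ * (1 - c • 1))) :=
      (hPlim.const_sub 1).const_mul _
    have hr : Tendsto (fun k => (T (s k) : ℂ)⁻¹ • e (P (s k))) atTop (𝓝 ((0 : ℂ) • (c • 1))) :=
      (hTlim.comp hs.tendsto_atTop).smul hPlim
    have heq : (fun k => e φ * (1 - e (P (s k)))) = fun k => (T (s k) : ℂ)⁻¹ • e (P (s k)) := by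
      funext k
      have := congrArg e (hid (s k))
      simpa using this
    rw [heq] at hl
    have h6 := tendsto_nhds_unique hl hr
    have h7 : (1 - c) • e φ = 0 := by
      rw [zero_smul, mul_sub, mul_one, mul_smul_comm, mul_one] at h6
      rw [sub_smul, one_smul, h6]
    rcases smul_eq_zero.mp h7 with h | h
    · exact absurd (sub_eq_zero.mp h).symm hc1
    · exact (map_eq_zero_iff e e.injective).mp h
end
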